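/- arXiv:0910.2127 — 8 statements merged into one kernel-verified Lean document; each statement's English description precedes it below -/
import Mathlib

section
/- For all real numbers a, b, c, d with 0 < a < b < c < d, the lattices L₁ and L₂ are not isometric: there is no ℤ-linear bijection f : L₁ → L₂ satisfying B(f x, f y) = B(x, y) for all x, y ∈ L₁. -/
/-- The diagonal quadratic form `Q(x) = a x₀² + b x₁² + c x₂² + d x₃²` on `ℤ⁴`. -/
def Q (a b c d : ℝ) (x : Fin 4 → ℤ) : ℝ :=
  a * (x 0 : ℝ) ^ 2 + b * (x 1 : ℝ) ^ 2 + c * (x 2 : ℝ) ^ 2 + d * (x 3 : ℝ) ^ 2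

/-- The associated symmetric bilinear form on `ℤ⁴`. -/
def B (a b c d : ℝ) (x y : Fin 4 → ℤ) : ℝ :=
  a * (x 0 : ℝ) * (y 0 : ℝ) + b * (x 1 : ℝ) * (y 1 : ℝ) +
    c * (x 2 : ℝ) * (y 2 : ℝ) + d * (x 3 : ℝ) * (y 3 : ℝ)

def l0 : Fin 4 → ℤ := ![-1, 3, -1, 1]
def l1 : Fin 4 → ℤ := ![1, -1, -1, 3]
def l2 : Fin 4 → ℤ := ![-1, -1, 1, 3]
def l3 : Fin 4 → ℤ := ![-1, 1, -1, 3]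

/-- `L₁ = span_ℤ {l₀, l₁, 3 l₂, 3 l₃}`. -/
def L1 : Submodule ℤ (Fin 4 → ℤ) :=
  Submodule.span ℤ {l0, l1, (3 : ℤ) • l2, (3 : ℤ) • l3}

/-- `L₂ = span_ℤ {l₀, 3 l₁, l₂, 3 l₃}`. -/
def L2 : Submodule ℤ (Fin 4 → ℤ) :=
  Submodule.span ℤ {l0, (3 : ℤ) • l1, l2, (3 : ℤ) • l3}

/-! ### Kernel-friendly exhaustive search -/

noncomputable section

/-- `evalNat n p` is `p n`, with `n` reduced to a numeral before it is passed on. -/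
def evalNat (n : ℕ) (p : ℕ → Bool) : Bool :=
  Nat.rec (p 0) (fun k _ => p (Nat.succ k)) n

/-- `evalInt z p` is `p z`, with `z` reduced to a numeral before it is passed on. -/
def evalInt (z : ℤ) (p : ℤ → Bool) : Bool :=
  Int.rec (fun n => evalNat n fun k => p (.ofNat k)) (fun n => evalNat n fun k => p (.negSucc k)) z

theorem evalNat_eq (n : ℕ) (p : ℕ → Bool) : evalNat n p = p n := by
  cases n <;> rfl

theorem evalInt_eq (z : ℤ) (p : ℤ → Bool) : evalInt z p = p z := by
  cases z <;> simp only [evalInt, evalNat_eq]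

/-- Lazy implication of Booleans. -/
def whenever (c p : Bool) : Bool := Bool.rec true p c

theorem whenever_eq_true {c p : Bool} : whenever c p = true ↔ (c = true → p = true) := by
  cases c <;> simp [whenever]

/-- Lazy conjunction of Booleans. -/
def both (c p : Bool) : Bool := Bool.rec false p c

theorem both_eq_true {c p : Bool} : both c p = true ↔ c = true ∧ p = true := by
  cases c <;> simp [both]

/-- The value is `p` if `c` holds, and `q` otherwise. -/
def select (c p q : Bool) : Bool := Bool.rec q p c

theorem select_true (p q : Bool) : select true p q = p := rfl

theorem select_false (p q : Bool) : select false p q = q := rfl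

def isZero (z : ℤ) : Bool := Int.rec (fun n => Nat.beq n 0) (fun _ => false) z

theorem isZero_iff {z : ℤ} : isZero z = true ↔ z = 0 := by
  cases z <;> simp [isZero]

def divides (m : ℕ) (z : ℤ) : Bool := Nat.beq (z.natAbs % m) 0

theorem divides_iff {m : ℕ} {z : ℤ} : divides m z = true ↔ (m : ℤ) ∣ z := by
  simp [divides, Int.natCast_dvd, Nat.dvd_iff_mod_eq_zero]

/-- `p k` holds for all `k < n`. -/
def allBelow (n : ℕ) (p : ℕ → Bool) : Bool :=
  Nat.rec true (fun k ih => both (p k) ih) n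

theorem allBelow_sound {n : ℕ} {p : ℕ → Bool} (h : allBelow n p = true) {k : ℕ} (hk : k < n) :
    p k = true := by
  induction n with
  | zero => omega
  | succ n ih =>
    obtain ⟨hn, h⟩ := both_eq_true.mp h
    rcases Nat.lt_succ_iff_lt_or_eq.mp hk with hk | rfl
    · exact ih h hk
    · exact hn

/-- `p x` holds for all integers `x` with `x ^ 2 ≤ 144`. -/
def allDiag (p : ℤ → Bool) : Bool :=
  allBelow 25 fun k => evalInt (k - 12) p

theorem allDiag_sound {p : ℤ → Bool} (h : allDiag p = true) {x : ℤ} (hx : x * x ≤ 144) :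
    p x = true := by
  have h1 : -12 ≤ x := by nlinarith
  have h2 : x ≤ 12 := by nlinarith
  have := allBelow_sound h (k := (x + 12).toNat) (by omega)
  simp only [evalInt_eq] at this
  rwa [show (((x + 12).toNat : ℕ) : ℤ) - 12 = x by omega] at this

/-- `p k n (s - k * n)` holds for all `k ≡ a` and `n ≡ b` modulo `m` with `0 < k < n` and
`k * n ≤ s ≤ 144` and `k * num = n * den`. -/
def allPosPairs (m s a b num den : ℕ) (p : ℕ → ℕ → ℕ → Bool) : Bool :=
  allBelow (Nat.succ (Nat.div 11 m)) fun i => evalNat (Nat.add a (Nat.mul m i)) fun k =>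
  whenever (Nat.blt 0 k) <| whenever (Nat.blt (Nat.mul k k) s) <|
  select (Nat.beq den 0)
    (allBelow (Nat.succ (Nat.div (Nat.div s k) m)) fun j =>
      evalNat (Nat.add b (Nat.mul m j)) fun n =>
      whenever (Nat.blt k n) <| whenever (Nat.ble (Nat.mul k n) s) <|
      evalNat (Nat.sub s (Nat.mul k n)) fun r => p k n r)
    (evalNat (Nat.div (Nat.mul k num) den) fun n =>
      whenever (Nat.beq (Nat.mul n den) (Nat.mul k num)) <| whenever (Nat.beq (Nat.mod n m) b) <|
      whenever (Nat.blt k n) <| whenever (Nat.ble (Nat.mul k n) s) <|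
      evalNat (Nat.sub s (Nat.mul k n)) fun r => p k n r)

theorem exists_eq_add_of_mod_eq {m z a : ℕ} (h : z % m = a) : z = a + m * (z / m) := by
  rw [← h, Nat.mod_add_div]

theorem allPosPairs_sound {m s a b num den : ℕ} {p : ℕ → ℕ → ℕ → Bool}
    (h : allPosPairs m s a b num den p = true) (hs : s ≤ 144) {k n : ℕ} (hk : k % m = a)
    (hn : n % m = b) (hk0 : 0 < k) (hkn : k < n) (hks : k * n ≤ s) (hr : k * num = n * den) :
    p k n (s - k * n) = true := by
  have hkk : k * k < s := (Nat.mul_lt_mul_of_pos_left hkn hk0).trans_le hks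
  have hk11 : k ≤ 11 := by nlinarith
  simp only [allPosPairs, evalNat_eq] at h
  have h := allBelow_sound h (k := k / m) (Nat.lt_succ_of_le (Nat.div_le_div_right hk11))
  simp only [Nat.add_eq, Nat.mul_eq, Nat.sub_eq] at h
  rw [← exists_eq_add_of_mod_eq hk] at h
  simp only [whenever_eq_true, Nat.blt_eq] at h
  replace h := h hk0 hkk
  rcases Nat.eq_zero_or_pos den with rfl | hd
  · have h := allBelow_sound (select_true _ _ ▸ h) (k := n / m) (Nat.lt_succ_of_le
      (Nat.div_le_div_right ((Nat.le_div_iff_mul_le hk0).mpr (by rwa [mul_comm]))))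
    rw [← exists_eq_add_of_mod_eq hn] at h
    simp only [whenever_eq_true, Nat.blt_eq, Nat.ble_eq] at h
    exact h hkn hks
  · have hdiv : Nat.div (n * den) den = n := Nat.mul_div_cancel _ hd
    rw [show Nat.beq den 0 = false by cases den with | zero => omega | succ => rfl,
      select_false, hr,
      hdiv] at h
    simp only [whenever_eq_true, Nat.blt_eq, Nat.ble_eq, Nat.beq_eq] at h
    exact h trivial hn hkn hks

/-- `p k n 0` holds for all `k ≡ a` and `n ≡ b` modulo `m` with `0 < k < n` and
`k * n = s ≤ 144`. -/
def allPosFactors (m s a b : ℕ) (p : ℕ → ℕ → ℕ → Bool) : Bool :=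
  allBelow (Nat.succ (Nat.div 11 m)) fun i => evalNat (Nat.add a (Nat.mul m i)) fun k =>
  whenever (Nat.blt 0 k) <| whenever (Nat.blt (Nat.mul k k) s) <|
  evalNat (Nat.div s k) fun n => whenever (Nat.beq (Nat.mul n k) s) <|
  whenever (Nat.beq (Nat.mod n m) b) <| p k n 0

theorem allPosFactors_sound {m s a b : ℕ} {p : ℕ → ℕ → ℕ → Bool}
    (h : allPosFactors m s a b p = true) (hs : s ≤ 144) {k n : ℕ} (hk : k % m = a)
    (hn : n % m = b) (hk0 : 0 < k) (hkn : k < n) (hks : n * k = s) : p k n 0 = true := by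
  have hkk : k * k < s := hks ▸ Nat.mul_lt_mul_of_pos_right hkn hk0
  have hk11 : k ≤ 11 := by nlinarith
  simp only [allPosFactors, evalNat_eq] at h
  have h := allBelow_sound h (k := k / m) (Nat.lt_succ_of_le (Nat.div_le_div_right hk11))
  simp only [Nat.add_eq, Nat.mul_eq] at h
  rw [← exists_eq_add_of_mod_eq hk] at h
  simp only [whenever_eq_true, Nat.blt_eq, Nat.beq_eq] at h
  replace h := h hk0 hkk
  rw [← hks, show Nat.div (n * k) k = n from Nat.mul_div_cancel _ hk0] at h
  exact h rfl hn

/-- The residue of `z` modulo `m`. -/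
def residue (m : ℕ) (z : ℤ) : ℕ :=
  Int.rec (fun n => Nat.mod n m) (fun n => Nat.sub (Nat.pred m) (Nat.mod n m)) z

theorem residue_eq {m : ℕ} (hm : 0 < m) (z : ℤ) : residue m z = z % m := by
  cases z with
  | ofNat n => rfl
  | negSucc n =>
    have : n % m < m := Nat.mod_lt n hm
    rw [Int.negSucc_emod n (by exact_mod_cast hm)]
    change ((m - 1 - n % m : ℕ) : ℤ) = _
    push_cast [Nat.cast_sub (show n % m ≤ m - 1 by omega), Nat.cast_sub (show 1 ≤ m from hm)]
    ring

theorem natAbs_mod_eq_residue {m : ℕ} (hm : 0 < m) {x a : ℤ} (hx0 : 0 ≤ x)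
    (hx : (m : ℤ) ∣ x - a) : x.natAbs % m = residue m a := by
  zify
  rw [residue_eq hm, abs_of_nonneg hx0]
  exact Int.emod_eq_emod_iff_emod_sub_eq_zero.mpr (Int.emod_eq_zero_of_dvd hx)

theorem natAbs_mod_eq_sub_residue {m : ℕ} (hm : 0 < m) {x a : ℤ} (hx0 : x ≤ 0)
    (hx : (m : ℤ) ∣ x - a) : x.natAbs % m = Nat.mod (Nat.sub m (residue m a)) m := by
  have h1 := residue_eq hm a
  have h2 := Int.emod_lt_of_pos a (show (0 : ℤ) < m by exact_mod_cast hm)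
  change _ = (m - residue m a) % m
  zify
  rw [Nat.cast_sub (by omega), h1, abs_of_nonpos hx0, Int.emod_eq_emod_iff_emod_sub_eq_zero]
  refine Int.emod_eq_zero_of_dvd ?_
  obtain ⟨k, hk⟩ := hx
  exact ⟨-k - 1 - a / m, by linear_combination -hk + Int.mul_ediv_add_emod a m⟩

/-- `x` and `y` vanish, or they have the same sign and `|x| < |y|`. -/
def Nested (x y : ℤ) : Prop := x = 0 ∧ y = 0 ∨ 0 < x ∧ x < y ∨ x < 0 ∧ y < x

/-- Runs a search `q` over positive pairs for both signs, and adds the case `z` of the pair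
`(0, 0)`. The first two arguments of `q` are the residues modulo `m` of the absolute values. -/
def allSigns (m : ℕ) (a b : ℤ) (q : ℕ → ℕ → (ℕ → ℕ → ℕ → Bool) → Bool) (z : Bool)
    (p : ℤ → ℤ → ℕ → Bool) : Bool :=
  evalNat (residue m a) fun r => evalNat (residue m b) fun t =>
  both (whenever (Nat.beq r 0) (whenever (Nat.beq t 0) z)) <|
  both (q r t fun k n => p (Int.ofNat k) (Int.ofNat n)) <|
  evalNat (Nat.mod (Nat.sub m r) m) fun r => evalNat (Nat.mod (Nat.sub m t) m) fun t =>
  q r t fun k n => p (Int.negSucc (Nat.pred k)) (Int.negSucc (Nat.pred n))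

theorem allSigns_sound {m : ℕ} (hm : 0 < m) {a b : ℤ}
    {q : ℕ → ℕ → (ℕ → ℕ → ℕ → Bool) → Bool} {z : Bool} {p : ℤ → ℤ → ℕ → Bool}
    (h : allSigns m a b q z p = true) {x y : ℤ} {j : ℕ} (hx : (m : ℤ) ∣ x - a)
    (hy : (m : ℤ) ∣ y - b) (hxy : Nested x y)
    (hz : x = 0 → y = 0 → z = true → p x y j = true)
    (hq : ∀ p' : ℕ → ℕ → ℕ → Bool, 0 < x.natAbs → x.natAbs < y.natAbs →
      q (x.natAbs % m) (y.natAbs % m) p' = true → p' x.natAbs y.natAbs j = true) :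
    p x y j = true := by
  simp only [allSigns, evalNat_eq, both_eq_true, whenever_eq_true, Nat.beq_eq] at h
  obtain ⟨h0, h1, h2⟩ := h
  rcases hxy with ⟨rfl, rfl⟩ | ⟨h, h'⟩ | ⟨h, h'⟩
  · exact hz rfl rfl (h0 (natAbs_mod_eq_residue hm le_rfl hx ▸ by simp)
      (natAbs_mod_eq_residue hm le_rfl hy ▸ by simp))
  · rw [← natAbs_mod_eq_residue hm h.le hx, ← natAbs_mod_eq_residue hm (h.trans h').le hy] at h1
    have := hq _ (by omega) (by omega) h1
    simpa [abs_of_pos h, abs_of_pos (h.trans h')] using this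
  · rw [← natAbs_mod_eq_sub_residue hm h.le hx,
      ← natAbs_mod_eq_sub_residue hm (h'.trans h).le hy] at h2
    have := hq _ (by omega) (by omega) h2
    rwa [show Int.negSucc (Nat.pred x.natAbs) = x by rw [Nat.pred_eq_sub_one]; omega,
      show Int.negSucc (Nat.pred y.natAbs) = y by rw [Nat.pred_eq_sub_one]; omega] at this

/-- `p x y (s - x * y)` holds for all `x ≡ a` and `y ≡ b` modulo `m` with `Nested x y`,
`x * y ≤ s ≤ 144` and `x * num = y * den`. -/
def allPairs (m s : ℕ) (a b num den : ℤ) (p : ℤ → ℤ → ℕ → Bool) : Bool :=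
  evalNat num.natAbs fun num => evalNat den.natAbs fun den =>
  allSigns m a b (fun r t => allPosPairs m s r t num den) (p 0 0 s) p

theorem natCast_natAbs_mul_of_nested {x y : ℤ} (h : Nested x y) :
    ((x.natAbs * y.natAbs : ℕ) : ℤ) = x * y := by
  rw [← Int.natAbs_mul]
  refine Int.natAbs_of_nonneg ?_
  rcases h with ⟨rfl, rfl⟩ | ⟨h, h'⟩ | ⟨h, h'⟩ <;> nlinarith

theorem allPairs_sound {m s : ℕ} {a b num den : ℤ} {p : ℤ → ℤ → ℕ → Bool}
    (h : allPairs m s a b num den p = true) {x y : ℤ} {j : ℕ} (hm : 0 < m) (hs : s ≤ 144)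
    (hx : (m : ℤ) ∣ x - a) (hy : (m : ℤ) ∣ y - b) (hxy : Nested x y)
    (hj : x * y + j = s) (hr : x * num = y * den) : p x y j = true := by
  have hprod := natCast_natAbs_mul_of_nested hxy
  have hj' : j = s - x.natAbs * y.natAbs := by omega
  simp only [allPairs, evalNat_eq] at h
  refine allSigns_sound hm h hx hy hxy ?_ fun p' hx0 hlt hp => ?_
  · rintro rfl rfl hz
    simpa [hj'] using hz
  · rw [hj']
    exact allPosPairs_sound hp hs rfl rfl hx0 hlt (by omega)
      (by rw [← Int.natAbs_mul, ← Int.natAbs_mul, hr])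

/-- `p x y` holds for all `x ≡ a` and `y ≡ b` modulo `m` with `Nested x y` and
`x * y = s ≤ 144`. -/
def allFactors (m s : ℕ) (a b : ℤ) (p : ℤ → ℤ → Bool) : Bool :=
  allSigns m a b (fun r t => allPosFactors m s r t) (whenever (Nat.beq s 0) (p 0 0))
    fun x y _ => p x y

theorem allFactors_sound {m s : ℕ} {a b : ℤ} {p : ℤ → ℤ → Bool}
    (h : allFactors m s a b p = true) {x y : ℤ} (hm : 0 < m) (hs : s ≤ 144)
    (hx : (m : ℤ) ∣ x - a) (hy : (m : ℤ) ∣ y - b) (hxy : Nested x y) (hj : x * y = s) :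
    p x y = true := by
  have hprod := natCast_natAbs_mul_of_nested hxy
  refine allSigns_sound (j := 0) hm h hx hy hxy ?_ fun p' hx0 hlt hp => ?_
  · rintro rfl rfl hz
    rw [whenever_eq_true, Nat.beq_eq] at hz
    exact hz (by simpa using hj.symm)
  · exact allPosFactors_sound hp hs rfl rfl hx0 hlt (by rw [mul_comm]; omega)

/-- `u * u' = 0`, or the absolute value of `w / u` is smaller than that of `w' / u'`. -/
def ratioLt (u w u' w' : ℤ) : Bool :=
  select (isZero u) true <| select (isZero u') true <|
  Nat.blt (Nat.mul w.natAbs u'.natAbs) (Nat.mul w'.natAbs u.natAbs)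

theorem ratioLt_eq_true {u w u' w' : ℤ}
    (h : u ≠ 0 → u' ≠ 0 → w.natAbs * u'.natAbs < w'.natAbs * u.natAbs) :
    ratioLt u w u' w' = true := by
  unfold ratioLt
  rcases hu : isZero u with - | -
  · rcases hu' : isZero u' with - | -
    · exact Nat.blt_eq.mpr (h (by rintro rfl; cases hu) (by rintro rfl; cases hu'))
    · rfl
  · rfl

/-- Columns `u` and `w`, with the same index, of two `4 × 4` integer matrices. -/
structure Col where
  (u0 u1 u2 u3 w0 w1 w2 w3 : ℤ)

def areOrthogonal (c e : Col) : Bool :=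
  both (isZero (c.u0 * e.w0 + c.u1 * e.w1 + c.u2 * e.w2 + c.u3 * e.w3)) <|
  isZero (e.u0 * c.w0 + e.u1 * c.w1 + e.u2 * c.w2 + e.u3 * c.w3)

/-- Search for column `0`, with nonnegative entry `0`. -/
def searchCol0 (p : Col → Bool) : Bool :=
  allBelow 13 fun n => evalInt (Int.ofNat n) fun t => evalNat (144 - t * t).toNat fun s0 =>
  allPairs 2 s0 t t 0 0 fun u1 w1 s1 =>
  whenever (ratioLt t t u1 w1) <|
  allPairs 6 s1 (3 * t - 2 * (t + u1)) (3 * t - 2 * (t + w1)) 0 0 fun u2 w2 s2 =>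
  whenever (ratioLt t t u2 w2) <| whenever (ratioLt u1 w1 u2 w2) <|
  allFactors 12 s2 (t + u2 - 3 * u1) (t + w2 - 3 * w1) fun u3 w3 =>
  whenever (ratioLt t t u3 w3) <| whenever (ratioLt u1 w1 u3 w3) <|
  whenever (ratioLt u2 w2 u3 w3) <| p ⟨t, u1, u2, u3, t, w1, w2, w3⟩

/-- Search for column `3`, given column `0`. -/
def searchCol3 (c : Col) (p : Col → Bool) : Bool :=
  allDiag fun t => whenever (divides 2 (t - c.u0)) <|
  evalNat (144 - t * t).toNat fun s0 =>
  evalInt (t - c.u3) fun x => evalInt (t - c.w3) fun y =>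
  allPairs 4 s0 (c.w0 + y) (c.u0 + x) c.w3 c.u3 fun w0 u0 s1 =>
  allPairs 12 s1 (9 * (c.w1 + y) + 4 * (t + w0)) (9 * (c.u1 + x) + 4 * (t + u0))
    (c.u1 * c.w3) (c.w1 * c.u3) fun w1 u1 s2 =>
  allPairs 12 s2 (9 * (c.w2 + y) + 4 * (w0 + w1)) (9 * (c.u2 + x) + 4 * (u0 + u1))
    (c.u2 * c.w3) (c.w2 * c.u3) fun w2 u2 s3 =>
  whenever (Nat.beq s3 0) <|
  whenever (areOrthogonal ⟨u0, u1, u2, t, w0, w1, w2, t⟩ c) <| p ⟨u0, u1, u2, t, w0, w1, w2, t⟩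

/-- Search for column `1`, given columns `0` and `3`. -/
def searchCol1 (c e : Col) (p : Col → Bool) : Bool :=
  allDiag fun t => whenever (divides 2 (t - c.u0)) <| whenever (divides 3 (t + c.u1 + e.u1)) <|
  evalNat (144 - t * t).toNat fun s0 =>
  allPairs 12 s0 (9 * (c.w0 + t - c.w1) - 4 * (c.w0 + e.w0))
    (9 * (c.u0 + t - c.u1) - 4 * (c.u0 + e.u0)) c.w1 c.u1 fun w0 u0 s1 =>
  allPairs 12 s1 (9 * (c.u2 + t - c.u1) - 4 * (c.u2 + e.u2))
    (9 * (c.w2 + t - c.w1) - 4 * (c.w2 + e.w2)) (c.w2 * c.u1) (c.u2 * c.w1) fun u2 w2 s2 =>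
  allPairs 12 s2 (9 * (c.u3 + t - c.u1) - 4 * (c.u3 + e.u3))
    (9 * (c.w3 + t - c.w1) - 4 * (c.w3 + e.w3)) (c.w3 * c.u1) (c.u3 * c.w1) fun u3 w3 s3 =>
  whenever (Nat.beq s3 0) <|
  whenever (areOrthogonal ⟨u0, t, u2, u3, w0, t, w2, w3⟩ c) <|
  whenever (areOrthogonal ⟨u0, t, u2, u3, w0, t, w2, w3⟩ e) <| p ⟨u0, t, u2, u3, w0, t, w2, w3⟩

/-- Search for column `2`, given columns `0`, `1` and `3`. -/
def searchCol2 (c d e : Col) (p : Col → Bool) : Bool :=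
  evalNat (144 - c.u0 * c.w0 - d.u0 * d.w0 - e.u0 * e.w0).toNat fun r0 =>
  evalNat (144 - c.u1 * c.w1 - d.u1 * d.w1 - e.u1 * e.w1).toNat fun r1 =>
  evalInt (144 - c.u2 * c.w2 - d.u2 * d.w2 - e.u2 * e.w2) fun r2 =>
  evalNat (144 - c.u3 * c.w3 - d.u3 * d.w3 - e.u3 * e.w3).toNat fun r3 =>
  allDiag fun t => whenever (isZero (r2 - t * t)) <|
  whenever (divides 12 (t - (-c.u2 + 3 * d.u2 + e.u2))) <|
  allFactors 12 r0 (-c.w0 + 3 * d.w0 + e.w0) (-c.u0 + 3 * d.u0 + e.u0) fun w0 u0 =>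
  allFactors 12 r1 (-c.w1 + 3 * d.w1 + e.w1) (-c.u1 + 3 * d.u1 + e.u1) fun w1 u1 =>
  allFactors 12 r3 (-c.u3 + 3 * d.u3 + e.u3) (-c.w3 + 3 * d.w3 + e.w3) fun u3 w3 =>
  p ⟨u0, u1, t, u3, w0, w1, t, w3⟩

/-- `∑ i, y i * c.u i`. -/
def Col.pair (y : Fin 4 → ℤ) (c : Col) : ℤ := y 0 * c.u0 + y 1 * c.u1 + y 2 * c.u2 + y 3 * c.u3

/-- The value of the bilinear form with matrix `u` at `y` and `l` is not divisible by `144`. -/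
def obstructed (c d f e : Col) (y l : Fin 4 → ℤ) : Bool :=
  !divides 144 (c.pair y * l 0 + d.pair y * l 1 + f.pair y * l 2 + e.pair y * l 3)

/-- All matrices found by the search violate an integrality condition. -/
def search : Bool :=
  searchCol0 fun c => searchCol3 c fun e => searchCol1 c e fun d => searchCol2 c d e fun f =>
  obstructed c d f e l0 l0 || obstructed c d f e l2 l0 || obstructed c d f e l2 l1 ||
    obstructed c d f e l0 ((3 : ℤ) • l2)

theorem search_eq_true : search = true := by
  decide +kernel

/-! ### The lattices -/

theorem vec_mem_L1 (p q r s : ℤ) :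
    ![-p + q - 3 * r - 3 * s, 3 * p - q - 3 * r + 3 * s, -p - q + 3 * r - 3 * s,
      p + 3 * q + 9 * r + 9 * s] ∈ L1 := by
  have h : p • l0 + q • l1 + r • (3 : ℤ) • l2 + s • (3 : ℤ) • l3 ∈ L1 := by
    refine add_mem (add_mem (add_mem ?_ ?_) ?_) ?_ <;>
      exact L1.smul_mem _ (Submodule.subset_span (by simp))
  convert h using 1
  ext i
  fin_cases i <;> simp [l0, l1, l2, l3] <;> ring

theorem vec_mem_L2 (p q r s : ℤ) :
    ![-p + 3 * q - r - 3 * s, 3 * p - 3 * q - r + 3 * s, -p - 3 * q + r - 3 * s,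
      p + 9 * q + 3 * r + 9 * s] ∈ L2 := by
  have h : p • l0 + q • (3 : ℤ) • l1 + r • l2 + s • (3 : ℤ) • l3 ∈ L2 := by
    refine add_mem (add_mem (add_mem ?_ ?_) ?_) ?_ <;>
      exact L2.smul_mem _ (Submodule.subset_span (by simp))
  convert h using 1
  ext i
  fin_cases i <;> simp [l0, l1, l2, l3] <;> ring

theorem single_mem_L1 (j : Fin 4) : Pi.single j 12 ∈ L1 := by
  fin_cases j
  · convert vec_mem_L1 9 9 1 (-5) using 1; decide
  · convert vec_mem_L1 9 3 1 (-3) using 1; decide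
  · convert vec_mem_L1 9 3 3 (-5) using 1; decide
  · convert vec_mem_L1 3 3 1 (-1) using 1; decide

theorem single_mem_L2 (j : Fin 4) : Pi.single j 12 ∈ L2 := by
  fin_cases j
  · convert vec_mem_L2 9 3 3 (-5) using 1; decide
  · convert vec_mem_L2 9 1 3 (-3) using 1; decide
  · convert vec_mem_L2 9 1 9 (-5) using 1; decide
  · convert vec_mem_L2 3 1 3 (-1) using 1; decide

theorem single_sub_single_mem_L1 (j : Fin 4) : Pi.single j 6 - Pi.single 0 6 ∈ L1 := by
  fin_cases j
  · simp
  · convert vec_mem_L1 0 (-3) 0 1 using 1; decide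
  · convert vec_mem_L1 0 (-3) 1 0 using 1; decide
  · convert vec_mem_L1 (-3) (-3) 0 2 using 1; decide

theorem single_sub_single_mem_L2 (j : Fin 4) : Pi.single j 6 - Pi.single 0 6 ∈ L2 := by
  fin_cases j
  · simp
  · convert vec_mem_L2 0 (-1) 0 1 using 1; decide
  · convert vec_mem_L2 0 (-1) 3 0 using 1; decide
  · convert vec_mem_L2 (-3) (-1) 0 2 using 1; decide

/-- The bilinear form with matrix `M` maps `L2 × L1` into `144 ℤ`. -/
def IsIntegralPairing (M : Fin 4 → Fin 4 → ℤ) : Prop :=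
  ∀ l ∈ L1, ∀ y ∈ L2, 144 ∣ ∑ i, ∑ j, y i * M i j * l j

theorem IsIntegralPairing.column {M : Fin 4 → Fin 4 → ℤ} (hM : IsIntegralPairing M) (j : Fin 4) :
    12 ∣ -M 0 j + 3 * M 1 j - M 2 j + M 3 j ∧ 4 ∣ M 0 j - M 1 j - M 2 j + 3 * M 3 j ∧
      12 ∣ -M 0 j - M 1 j + M 2 j + 3 * M 3 j ∧ 4 ∣ -M 0 j + M 1 j - M 2 j + 3 * M 3 j := by
  have h0 := hM _ (single_mem_L1 j) _ (vec_mem_L2 1 0 0 0)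
  have h1 := hM _ (single_mem_L1 j) _ (vec_mem_L2 0 1 0 0)
  have h2 := hM _ (single_mem_L1 j) _ (vec_mem_L2 0 0 1 0)
  have h3 := hM _ (single_mem_L1 j) _ (vec_mem_L2 0 0 0 1)
  simp [Pi.single_apply, Fin.sum_univ_four] at h0 h1 h2 h3
  omega

theorem IsIntegralPairing.row {M : Fin 4 → Fin 4 → ℤ} (hM : IsIntegralPairing M) (i : Fin 4) :
    12 ∣ -M i 0 + 3 * M i 1 - M i 2 + M i 3 ∧ 12 ∣ M i 0 - M i 1 - M i 2 + 3 * M i 3 ∧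
      4 ∣ -M i 0 - M i 1 + M i 2 + 3 * M i 3 ∧ 4 ∣ -M i 0 + M i 1 - M i 2 + 3 * M i 3 := by
  have h0 := hM _ (vec_mem_L1 1 0 0 0) _ (single_mem_L2 i)
  have h1 := hM _ (vec_mem_L1 0 1 0 0) _ (single_mem_L2 i)
  have h2 := hM _ (vec_mem_L1 0 0 1 0) _ (single_mem_L2 i)
  have h3 := hM _ (vec_mem_L1 0 0 0 1) _ (single_mem_L2 i)
  simp [Pi.single_apply, Fin.sum_univ_four] at h0 h1 h2 h3
  omega

theorem IsIntegralPairing.cross {M : Fin 4 → Fin 4 → ℤ} (hM : IsIntegralPairing M) (i j : Fin 4) :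
    4 ∣ M i j - M i 0 - M 0 j + M 0 0 := by
  have h := hM _ (single_sub_single_mem_L1 j) _ (single_sub_single_mem_L2 i)
  simp [Pi.single_apply, mul_sub, sub_mul, Finset.sum_sub_distrib] at h
  omega

theorem IsIntegralPairing.column_three {M : Fin 4 → Fin 4 → ℤ} (hM : IsIntegralPairing M) :
    4 ∣ M 0 3 - (M 0 0 + (M 3 3 - M 3 0)) ∧
      12 ∣ M 1 3 - (9 * (M 1 0 + (M 3 3 - M 3 0)) + 4 * (M 3 3 + M 0 3)) ∧
      12 ∣ M 2 3 - (9 * (M 2 0 + (M 3 3 - M 3 0)) + 4 * (M 0 3 + M 1 3)) := by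
  obtain ⟨h, -, h', -⟩ := hM.column 3
  have h3 := hM.cross 3 3
  refine ⟨?_, ?_, ?_⟩
  · omega
  · have h1 := hM.cross 1 3
    have h4 : 4 ∣ M 1 3 - (M 1 0 + (M 3 3 - M 3 0)) := by omega
    have h3 : 3 ∣ M 1 3 - (M 3 3 + M 0 3) := by clear h1 h3; omega
    clear h h' h1
    omega
  · have h2 := hM.cross 2 3
    have h4 : 4 ∣ M 2 3 - (M 2 0 + (M 3 3 - M 3 0)) := by omega
    have h3 : 3 ∣ M 2 3 - (M 0 3 + M 1 3) := by clear h2 h3; omega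
    clear h h' h2
    omega

theorem IsIntegralPairing.three_dvd {M : Fin 4 → Fin 4 → ℤ} (hM : IsIntegralPairing M)
    (i : Fin 4) : 3 ∣ M i 1 + M i 0 + M i 3 := by
  have h := hM.row i
  omega

theorem IsIntegralPairing.column_one {M : Fin 4 → Fin 4 → ℤ} (hM : IsIntegralPairing M)
    (i : Fin 4) : 12 ∣ M i 1 - (9 * (M i 0 + M 1 1 - M 1 0) - 4 * (M i 0 + M i 3)) := by
  have h3 := hM.three_dvd i
  have h4 : 4 ∣ M i 1 - (M i 0 + M 1 1 - M 1 0) := by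
    have h := hM.cross i 1
    have h1 := hM.cross 1 1
    omega
  omega

theorem IsIntegralPairing.column_zero {M : Fin 4 → Fin 4 → ℤ} (hM : IsIntegralPairing M) :
    2 ∣ M 1 0 - M 0 0 ∧ 6 ∣ M 2 0 - (3 * M 0 0 - 2 * (M 0 0 + M 1 0)) ∧
      12 ∣ M 3 0 - (M 0 0 + M 2 0 - 3 * M 1 0) := by
  obtain ⟨h0, h1, h2, h3⟩ := hM.column 0
  refine ⟨?_, ?_, ?_⟩
  · clear h1 h3
    omega
  · clear h1
    omega
  · clear h1 h2 h3
    omega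

/-! ### Soundness of the search -/

/-- The conditions used by the search on a pair of matrices `u`, `w`. If `f` is an isometry from
`L1` to `L2`, then they hold for the matrix `u` of `12 * f` and the transpose `w` of the matrix of
`12 * f⁻¹`. -/
structure IsTransition (u w : Fin 4 → Fin 4 → ℤ) : Prop where
  nonneg : 0 ≤ u 0 0
  diag : ∀ j, u j j = w j j
  nested_of_lt : ∀ {i j}, j < i → Nested (u i j) (w i j)
  nested_of_gt : ∀ {i j}, i < j → Nested (w i j) (u i j)
  ratio : ∀ i j k, w i j * w j k * u i k = u i j * u j k * w i k
  symm_ratio : ∀ i j, w i j * w j i = u i j * u j i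
  ratio_lt : ∀ i j k, k < i → u k j ≠ 0 → u i j ≠ 0 →
    (w k j).natAbs * (u i j).natAbs < (w i j).natAbs * (u k j).natAbs
  col : ∀ j, ∑ i, u i j * w i j = 144
  orthogonality : ∀ j k, j ≠ k → ∑ i, u i j * w i k = 0
  row : ∀ i, ∑ j, u i j * w i j = 144
  integral_left : IsIntegralPairing u
  integral_right : IsIntegralPairing w

namespace IsTransition

variable {u w : Fin 4 → Fin 4 → ℤ}

/-- The `j`th columns of `u` and `w`. -/
def cols (u w : Fin 4 → Fin 4 → ℤ) (j : Fin 4) : Col :=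
  ⟨u 0 j, u 1 j, u 2 j, u 3 j, w 0 j, w 1 j, w 2 j, w 3 j⟩

theorem exists_natCast_eq_mul (h : IsTransition u w) (i j : Fin 4) :
    ∃ n : ℕ, u i j * w i j = n := by
  rcases lt_trichotomy i j with hij | rfl | hij
  · exact ⟨_, mul_comm (u i j) _ ▸ (natCast_natAbs_mul_of_nested (h.nested_of_gt hij)).symm⟩
  · rw [h.diag]
    exact ⟨_, (Int.natAbs_mul_self).symm⟩
  · exact ⟨_, (natCast_natAbs_mul_of_nested (h.nested_of_lt hij)).symm⟩

theorem exists_col_eq (h : IsTransition u w) (j : Fin 4) :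
    ∃ n : Fin 4 → ℕ, (∀ i, u i j * w i j = n i) ∧ n 0 + n 1 + n 2 + n 3 = 144 := by
  choose n hn using fun i => h.exists_natCast_eq_mul i j
  refine ⟨n, hn, ?_⟩
  have := h.col j
  simp only [Fin.sum_univ_four, hn] at this
  exact_mod_cast this

theorem areOrthogonal_eq_true (h : IsTransition u w) {j k : Fin 4} (hjk : j ≠ k) :
    areOrthogonal (cols u w j) (cols u w k) = true := by
  have h1 := h.orthogonality j k hjk
  have h2 := h.orthogonality k j hjk.symm
  simp only [Fin.sum_univ_four] at h1 h2
  simp only [areOrthogonal, both_eq_true, isZero_iff, cols]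
  exact ⟨h1, h2⟩

theorem two_dvd_sub (h : IsTransition u w) (i j : Fin 4) : 2 ∣ u i j - u 0 0 := by
  have h1 := h.integral_left.column j
  have h2 := h.integral_left.row 0
  fin_cases i <;> fin_cases j <;> simp at h1 ⊢ <;> omega

theorem ratioLt_col (h : IsTransition u w) (j : Fin 4) {i k : Fin 4} (hik : k < i) :
    ratioLt (u k j) (w k j) (u i j) (w i j) = true :=
  ratioLt_eq_true (h.ratio_lt i j k hik)

theorem searchCol0_sound (h : IsTransition u w) {p : Col → Bool} (hp : searchCol0 p = true) :
    p (cols u w 0) = true := by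
  obtain ⟨hu1, hu2, hu3⟩ := h.integral_left.column_zero
  obtain ⟨hw1, hw2, hw3⟩ := h.integral_right.column_zero
  have hd := h.diag 0
  obtain ⟨n, hn, hsum⟩ := h.exists_col_eq 0
  have h0 := hn 0
  rw [← hd] at h0 hw1 hw2 hw3
  have hr (i) (hi : 0 < i) : ratioLt (u 0 0) (u 0 0) (u i 0) (w i 0) = true := by
    simpa only [hd] using h.ratioLt_col 0 hi
  have h12 : u 0 0 ≤ 12 := by
    have : u 0 0 * u 0 0 ≤ 144 := by omega
    nlinarith
  have hp := allBelow_sound hp (k := (u 0 0).toNat) (by omega)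
  rw [evalInt_eq, Int.ofNat_eq_natCast, Int.toNat_of_nonneg h.nonneg, evalNat_eq,
    show (144 - u 0 0 * u 0 0).toNat = n 1 + n 2 + n 3 by omega] at hp
  have hp := allPairs_sound hp (x := u 1 0) (y := w 1 0) (j := n 2 + n 3) (by norm_num)
    (by omega) hu1 hw1 (h.nested_of_lt (by decide)) (by push_cast; linarith [hn 1]) (by simp)
  have hp := whenever_eq_true.mp hp (hr 1 (by decide))
  have hp := allPairs_sound hp (x := u 2 0) (y := w 2 0) (j := n 3) (by norm_num)
    (by omega) hu2 hw2 (h.nested_of_lt (by decide)) (by push_cast; linarith [hn 2]) (by simp)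
  have hp := whenever_eq_true.mp hp (hr 2 (by decide))
  have hp := whenever_eq_true.mp hp (h.ratioLt_col 0 (by decide))
  have hp := allFactors_sound hp (x := u 3 0) (y := w 3 0) (by norm_num)
    (by omega) hu3 hw3 (h.nested_of_lt (by decide)) (hn 3)
  have hp := whenever_eq_true.mp hp (hr 3 (by decide))
  have hp := whenever_eq_true.mp hp (h.ratioLt_col 0 (by decide))
  have hp := whenever_eq_true.mp hp (h.ratioLt_col 0 (by decide))
  simpa [cols, ← hd] using hp

theorem searchCol3_sound (h : IsTransition u w) {p : Col → Bool}
    (hp : searchCol3 (cols u w 0) p = true) : p (cols u w 3) = true := by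
  obtain ⟨hu0, hu1, hu2⟩ := h.integral_left.column_three
  obtain ⟨hw0, hw1, hw2⟩ := h.integral_right.column_three
  have hd := h.diag 3
  obtain ⟨n, hn, hsum⟩ := h.exists_col_eq 3
  have h3 := hn 3
  rw [← hd] at h3 hw0 hw1 hw2
  have hp := allDiag_sound hp (x := u 3 3) (by omega)
  have hp := whenever_eq_true.mp hp (divides_iff.mpr (h.two_dvd_sub 3 3))
  rw [evalNat_eq,
    show (144 - u 3 3 * u 3 3).toNat = n 0 + n 1 + n 2 by omega, evalInt_eq,
    evalInt_eq] at hp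
  simp only [cols] at hp
  have hp := allPairs_sound hp (x := w 0 3) (y := u 0 3) (j := n 1 + n 2) (by norm_num)
    (by omega) hw0 hu0 (h.nested_of_gt (by decide)) (by push_cast; linarith [hn 0])
    (h.symm_ratio 0 3)
  have hp := allPairs_sound hp (x := w 1 3) (y := u 1 3) (j := n 2) (by norm_num)
    (by omega) hw1 hu1 (h.nested_of_gt (by decide)) (by push_cast; linarith [hn 1])
    (by linear_combination h.ratio 1 3 0)
  have hp := allPairs_sound hp (x := w 2 3) (y := u 2 3) (j := 0) (by norm_num)
    (by omega) hw2 hu2 (h.nested_of_gt (by decide)) (by push_cast; linarith [hn 2])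
    (by linear_combination h.ratio 2 3 0)
  have ho := h.areOrthogonal_eq_true (j := 3) (k := 0) (by decide)
  have hc : cols u w 3 = ⟨u 0 3, u 1 3, u 2 3, u 3 3, w 0 3, w 1 3, w 2 3, u 3 3⟩ := by
    rw [cols, hd]
  rw [hc] at ho ⊢
  exact whenever_eq_true.mp (whenever_eq_true.mp hp rfl) ho

theorem searchCol1_sound (h : IsTransition u w) {p : Col → Bool}
    (hp : searchCol1 (cols u w 0) (cols u w 3) p = true) : p (cols u w 1) = true := by
  have hu := h.integral_left.column_one
  have hw := h.integral_right.column_one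
  have hd := h.diag 1
  obtain ⟨n, hn, hsum⟩ := h.exists_col_eq 1
  have h1 := hn 1
  rw [← hd] at h1 hw
  have hp := allDiag_sound hp (x := u 1 1) (by omega)
  have hp := whenever_eq_true.mp hp (divides_iff.mpr (h.two_dvd_sub 1 1))
  have hp := whenever_eq_true.mp hp (divides_iff.mpr (h.integral_left.three_dvd 1))
  rw [evalNat_eq,
    show (144 - u 1 1 * u 1 1).toNat = n 0 + n 2 + n 3 by omega] at hp
  simp only [cols] at hp
  have hp := allPairs_sound hp (x := w 0 1) (y := u 0 1) (j := n 2 + n 3) (by norm_num)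
    (by omega) (hw 0) (hu 0) (h.nested_of_gt (by decide)) (by push_cast; linarith [hn 0])
    (h.symm_ratio 0 1)
  have hp := allPairs_sound hp (x := u 2 1) (y := w 2 1) (j := n 3) (by norm_num)
    (by omega) (hu 2) (hw 2) (h.nested_of_lt (by decide)) (by push_cast; linarith [hn 2])
    (by linear_combination -h.ratio 2 1 0)
  have hp := allPairs_sound hp (x := u 3 1) (y := w 3 1) (j := 0) (by norm_num)
    (by omega) (hu 3) (hw 3) (h.nested_of_lt (by decide)) (by push_cast; linarith [hn 3])
    (by linear_combination -h.ratio 3 1 0)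
  have ho := h.areOrthogonal_eq_true (j := 1) (k := 0) (by decide)
  have ho' := h.areOrthogonal_eq_true (j := 1) (k := 3) (by decide)
  have hc : cols u w 1 = ⟨u 0 1, u 1 1, u 2 1, u 3 1, w 0 1, u 1 1, w 2 1, w 3 1⟩ := by
    rw [cols, hd]
  rw [hc] at ho ho' ⊢
  exact whenever_eq_true.mp (whenever_eq_true.mp (whenever_eq_true.mp hp rfl) ho) ho'

theorem searchCol2_sound (h : IsTransition u w) {p : Col → Bool}
    (hp : searchCol2 (cols u w 0) (cols u w 1) (cols u w 3) p = true) :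
    p (cols u w 2) = true := by
  have hu0 := h.integral_left.row 0
  have hu1 := h.integral_left.row 1
  have hu2 := h.integral_left.row 2
  have hu3 := h.integral_left.row 3
  have hw0 := h.integral_right.row 0
  have hw1 := h.integral_right.row 1
  have hw3 := h.integral_right.row 3
  have hd := h.diag 2
  have hrow := h.row
  simp only [Fin.sum_univ_four] at hrow
  obtain ⟨n, hn, hsum⟩ := h.exists_col_eq 2
  simp only [searchCol2, evalNat_eq, evalInt_eq, cols] at hp
  rw [show 144 - u 0 0 * w 0 0 - u 0 1 * w 0 1 - u 0 3 * w 0 3 = n 0 by linarith [hrow 0, hn 0],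
    show 144 - u 1 0 * w 1 0 - u 1 1 * w 1 1 - u 1 3 * w 1 3 = n 1 by linarith [hrow 1, hn 1],
    show 144 - u 2 0 * w 2 0 - u 2 1 * w 2 1 - u 2 3 * w 2 3 = u 2 2 * u 2 2 by
      linear_combination -hrow 2 - u 2 2 * hd,
    show 144 - u 3 0 * w 3 0 - u 3 1 * w 3 1 - u 3 3 * w 3 3 = n 3 by linarith [hrow 3, hn 3]] at hp
  simp only [Int.toNat_natCast] at hp
  have hp := allDiag_sound hp (x := u 2 2) (by linarith [hn 2, congrArg (u 2 2 * ·) hd])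
  rw [sub_self] at hp
  have hp := whenever_eq_true.mp hp rfl
  have hp := whenever_eq_true.mp hp (divides_iff.mpr (by push_cast; omega))
  have hp := allFactors_sound hp (x := w 0 2) (y := u 0 2) (by norm_num) (by omega) (by omega)
    (by omega) (h.nested_of_gt (by decide)) (by linarith [hn 0])
  have hp := allFactors_sound hp (x := w 1 2) (y := u 1 2) (by norm_num) (by omega) (by omega)
    (by omega) (h.nested_of_gt (by decide)) (by linarith [hn 1])
  have hp := allFactors_sound hp (x := u 3 2) (y := w 3 2) (by norm_num) (by omega) (by omega)
    (by omega) (h.nested_of_lt (by decide)) (by linarith [hn 3])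
  simpa [cols, ← hd] using hp

theorem obstructed_eq_false (h : IsTransition u w) {y l : Fin 4 → ℤ} (hl : l ∈ L1) (hy : y ∈ L2) :
    obstructed (cols u w 0) (cols u w 1) (cols u w 2) (cols u w 3) y l = false := by
  have h := h.integral_left l hl y hy
  refine congrArg not (divides_iff.mpr ?_)
  simp only [Fin.sum_univ_four] at h
  change 144 ∣ _
  convert h using 1
  simp only [cols, Col.pair]
  ring

end IsTransition

theorem not_isTransition (hs : search = true) (u w : Fin 4 → Fin 4 → ℤ) : ¬ IsTransition u w := by
  intro h
  have := h.searchCol2_sound (h.searchCol1_sound (h.searchCol3_sound (h.searchCol0_sound hs)))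
  have h0 : l0 ∈ L1 := Submodule.subset_span (by simp)
  have h1 : l1 ∈ L1 := Submodule.subset_span (by simp)
  have h2 : (3 : ℤ) • l2 ∈ L1 := Submodule.subset_span (by simp)
  have h0' : l0 ∈ L2 := Submodule.subset_span (by simp)
  have h2' : l2 ∈ L2 := Submodule.subset_span (by simp)
  simp [h.obstructed_eq_false, *, -zsmul_eq_mul] at this

/-! ### The transition matrices of an isometry -/

theorem dvd_dotProduct_of_mem_span {ι : Type*} [Fintype ι] {m : ℤ} {S : Set (ι → ℤ)}
    (hS : ∀ x ∈ S, ∀ y ∈ S, m ∣ x ⬝ᵥ y) {x y : ι → ℤ} (hx : x ∈ Submodule.span ℤ S)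
    (hy : y ∈ Submodule.span ℤ S) : m ∣ x ⬝ᵥ y := by
  induction hx, hy using Submodule.span_induction₂ with
  | mem_mem x y hx hy => exact hS x hx y hy
  | zero_left y hy => simp
  | zero_right x hx => simp
  | add_left x y z _ _ _ h h' => rw [add_dotProduct]; exact dvd_add h h'
  | add_right x y z _ _ _ h h' => rw [dotProduct_add]; exact dvd_add h h'
  | smul_left r x y _ _ h => rw [smul_dotProduct]; exact h.mul_left r
  | smul_right r x y _ _ h => rw [dotProduct_smul]; exact h.mul_left r

theorem dvd_dotProduct_of_mem_L1 {x y : Fin 4 → ℤ} (hx : x ∈ L1) (hy : y ∈ L1) :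
    12 ∣ x ⬝ᵥ y := by
  refine dvd_dotProduct_of_mem_span ?_ hx hy
  rintro x (rfl | rfl | rfl | rfl) y (rfl | rfl | rfl | rfl) <;> decide

theorem dvd_dotProduct_of_mem_L2 {x y : Fin 4 → ℤ} (hx : x ∈ L2) (hy : y ∈ L2) :
    12 ∣ x ⬝ᵥ y := by
  refine dvd_dotProduct_of_mem_span ?_ hx hy
  rintro x (rfl | rfl | rfl | rfl) y (rfl | rfl | rfl | rfl) <;> decide

/-- If `g` is linear on a lattice containing all `12 * e j`, then `12 * g l` is determined by the
values of `g` there. -/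
theorem sum_map_single_mul {L L' : Submodule ℤ (Fin 4 → ℤ)} (hL : ∀ j, Pi.single j 12 ∈ L)
    (g : L →ₗ[ℤ] L') (l : L) (i : Fin 4) :
    ∑ j, (g ⟨Pi.single j 12, hL j⟩ : Fin 4 → ℤ) i * (l : Fin 4 → ℤ) j =
      12 * (g l : Fin 4 → ℤ) i := by
  have h : (12 : ℤ) • l = ∑ j, (l : Fin 4 → ℤ) j • (⟨Pi.single j 12, hL j⟩ : L) := by
    ext k
    simp [Pi.single_apply, mul_comm]
  have h := congrArg (fun x => (g x : Fin 4 → ℤ) i) h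
  simp only [map_smul, map_sum, Submodule.coe_smul, Submodule.coe_sum, Finset.sum_apply,
    Pi.smul_apply, smul_eq_mul] at h
  rw [h]
  exact Finset.sum_congr rfl fun j _ => mul_comm _ _

section Isometry

variable (f : L1 ≃ₗ[ℤ] L2)

def transition (i j : Fin 4) : ℤ := (f ⟨_, single_mem_L1 j⟩ : Fin 4 → ℤ) i

def cotransition (i j : Fin 4) : ℤ := (f.symm ⟨_, single_mem_L2 i⟩ : Fin 4 → ℤ) j

theorem isIntegralPairing_transition : IsIntegralPairing (transition f) := by
  intro l hl y hy
  have h : ∑ i, ∑ j, y i * transition f i j * l j = 12 * (y ⬝ᵥ (f ⟨l, hl⟩ : Fin 4 → ℤ)) := by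
    simp only [dotProduct, Finset.mul_sum]
    refine Finset.sum_congr rfl fun i _ => ?_
    have h := sum_map_single_mul single_mem_L1 f.toLinearMap ⟨l, hl⟩ i
    simp only [LinearEquiv.coe_coe] at h
    rw [mul_left_comm, ← h, Finset.mul_sum]
    exact Finset.sum_congr rfl fun j _ => mul_assoc _ _ _
  rw [h]
  exact mul_dvd_mul_left 12 (dvd_dotProduct_of_mem_L2 hy (f ⟨l, hl⟩).2)

theorem isIntegralPairing_cotransition : IsIntegralPairing (cotransition f) := by
  intro l hl y hy
  have h : ∑ i, ∑ j, y i * cotransition f i j * l j =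
      12 * ((f.symm ⟨y, hy⟩ : Fin 4 → ℤ) ⬝ᵥ l) := by
    simp only [dotProduct, Finset.mul_sum]
    rw [Finset.sum_comm]
    refine Finset.sum_congr rfl fun j _ => ?_
    have h := sum_map_single_mul single_mem_L2 f.symm.toLinearMap ⟨y, hy⟩ j
    simp only [LinearEquiv.coe_coe] at h
    rw [← mul_assoc, ← h, Finset.sum_mul]
    exact Finset.sum_congr rfl fun i _ => congrArg (· * l j) (mul_comm _ _)
  rw [h]
  exact mul_dvd_mul_left 12 (dvd_dotProduct_of_mem_L1 (f.symm ⟨y, hy⟩).2 hl)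

variable {f} {D : Fin 4 → ℝ}

theorem sum_mul_single (x : Fin 4 → ℤ) (k : Fin 4) :
    ∑ i, D i * x i * (Pi.single k 12 : Fin 4 → ℤ) i = 12 * (D k * x k) := by
  simp [Pi.single_apply, mul_comm]

/-- `f` preserves the bilinear form with diagonal `D`. -/
def IsIsometry (D : Fin 4 → ℝ) (f : L1 ≃ₗ[ℤ] L2) : Prop :=
  ∀ x y : L1, ∑ i, D i * (f x : Fin 4 → ℤ) i * (f y : Fin 4 → ℤ) i =
    ∑ i, D i * (x : Fin 4 → ℤ) i * (y : Fin 4 → ℤ) i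

namespace IsIsometry

theorem mul_cotransition (hf : IsIsometry D f) (i j : Fin 4) :
    D j * cotransition f i j = D i * transition f i j := by
  have h := hf ⟨_, single_mem_L1 j⟩ (f.symm ⟨_, single_mem_L2 i⟩)
  rw [f.apply_symm_apply, sum_mul_single] at h
  have h' := sum_mul_single (D := D) (f.symm ⟨_, single_mem_L2 i⟩ : Fin 4 → ℤ) j
  simp only [mul_right_comm _ _ ((Pi.single j 12 : Fin 4 → ℤ) _ : ℝ)] at h'
  have := h.trans h'
  exact mul_left_cancel₀ (by norm_num : (12 : ℝ) ≠ 0) this.symm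

theorem sum_transition_mul (hf : IsIsometry D f) (hD : ∀ i, 0 < D i) (j k : Fin 4) :
    ∑ i, transition f i j * cotransition f i k = if j = k then 144 else 0 := by
  have h := hf ⟨_, single_mem_L1 j⟩ ⟨_, single_mem_L1 k⟩
  rw [sum_mul_single] at h
  have h' : D k * ∑ i, transition f i j * cotransition f i k =
      12 * (D k * (Pi.single j 12 : Fin 4 → ℤ) k) := by
    rw [← h]
    push_cast
    rw [Finset.mul_sum]
    refine Finset.sum_congr rfl fun i _ => ?_
    rw [mul_left_comm, hf.mul_cotransition]
    exact (mul_left_comm _ _ _).trans (mul_assoc _ _ _).symm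
  have h' := mul_left_cancel₀ (hD k).ne' (h'.trans (mul_left_comm _ _ _))
  rw [Pi.single_apply] at h'
  have h'' : ∑ i, transition f i j * cotransition f i k = 12 * if k = j then 12 else 0 := by
    exact_mod_cast h'
  rw [h'']
  simp only [mul_ite, eq_comm (a := k)]
  rfl

theorem sum_transition_mul_row (hf : IsIsometry D f) (hD : ∀ i, 0 < D i) (i : Fin 4) :
    ∑ j, transition f i j * cotransition f i j = 144 := by
  have h := hf (f.symm ⟨_, single_mem_L2 i⟩) (f.symm ⟨_, single_mem_L2 i⟩)
  rw [f.apply_symm_apply, sum_mul_single] at h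
  simp only [Pi.single_eq_same] at h
  have h' : D i * ∑ j, transition f i j * cotransition f i j = D i * (144 : ℤ) := by
    push_cast
    rw [Finset.mul_sum]
    trans 12 * (D i * (12 : ℤ))
    · rw [h]
      refine Finset.sum_congr rfl fun j _ => ?_
      rw [← mul_assoc, ← hf.mul_cotransition]
      rfl
    · push_cast
      ring
  exact_mod_cast mul_left_cancel₀ (hD i).ne' h'

theorem nested_of_mul_eq {p q : ℝ} (hp : 0 < p) (hpq : p < q) {x y : ℤ} (h : p * y = q * x) :
    Nested x y := by
  rcases lt_trichotomy x 0 with hx | rfl | hx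
  · refine Or.inr (Or.inr ⟨hx, ?_⟩)
    have hx : (x : ℝ) < 0 := by exact_mod_cast hx
    have : (y : ℝ) < x := by nlinarith
    exact_mod_cast this
  · simp only [Int.cast_zero, mul_zero, mul_eq_zero, hp.ne', false_or, Int.cast_eq_zero] at h
    exact Or.inl ⟨rfl, h⟩
  · refine Or.inr (Or.inl ⟨hx, ?_⟩)
    have hx : (0 : ℝ) < x := by exact_mod_cast hx
    have : (x : ℝ) < y := by nlinarith
    exact_mod_cast this

theorem isTransition (hf : IsIsometry D f) (hD : ∀ i, 0 < D i) (hmono : StrictMono D)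
    (hf0 : 0 ≤ transition f 0 0) : IsTransition (transition f) (cotransition f) where
  nonneg := hf0
  diag j := by exact_mod_cast mul_left_cancel₀ (hD j).ne' (hf.mul_cotransition j j).symm
  nested_of_lt hij := nested_of_mul_eq (hD _) (hmono hij) (hf.mul_cotransition _ _)
  nested_of_gt hij := nested_of_mul_eq (hD _) (hmono hij) (hf.mul_cotransition _ _).symm
  ratio i j k := by
    have h1 := hf.mul_cotransition i j
    have h2 := hf.mul_cotransition j k
    have h3 := hf.mul_cotransition i k
    have h : D i * D j * D k * (cotransition f i j * cotransition f j k * transition f i k) =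
        D i * D j * D k * (transition f i j * transition f j k * cotransition f i k) := by
      linear_combination (D k * cotransition f j k) * (D i * transition f i k) * h1 +
        D i * transition f i j * (D i * transition f i k) * h2 -
        D i * transition f i j * (D j * transition f j k) * h3
    exact_mod_cast mul_left_cancel₀ (by simp [(hD _).ne']) h
  symm_ratio i j := by
    have h1 := hf.mul_cotransition i j
    have h2 := hf.mul_cotransition j i
    have h : D i * D j * (cotransition f i j * cotransition f j i) =
        D i * D j * (transition f i j * transition f j i) := by
      linear_combination D i * cotransition f j i * h1 + D i * transition f i j * h2
    exact_mod_cast mul_left_cancel₀ (by simp [(hD _).ne']) h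
  ratio_lt i j k hki hk hi := by
    have h1 := congrArg abs (hf.mul_cotransition i j)
    have h2 := congrArg abs (hf.mul_cotransition k j)
    simp only [abs_mul, abs_of_pos (hD _)] at h1 h2
    have h : D j * (|(cotransition f k j : ℝ)| * |(transition f i j : ℝ)|) <
        D j * (|(cotransition f i j : ℝ)| * |(transition f k j : ℝ)|) := by
      rw [← mul_assoc, ← mul_assoc, h1, h2, mul_assoc, mul_assoc, mul_comm |(transition f i j : ℝ)|]
      exact mul_lt_mul_of_pos_right (hmono hki) (by positivity)
    have h := lt_of_mul_lt_mul_left h (hD j).le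
    zify
    exact_mod_cast h
  col j := by rw [hf.sum_transition_mul hD, if_pos rfl]
  orthogonality j k hjk := by rw [hf.sum_transition_mul hD, if_neg hjk]
  row := hf.sum_transition_mul_row hD
  integral_left := isIntegralPairing_transition f
  integral_right := isIntegralPairing_cotransition f

protected theorem neg (hf : IsIsometry D f) : IsIsometry D (f.trans (LinearEquiv.neg ℤ)) := by
  intro x y
  simpa using hf x y

end IsIsometry

end Isometry

end

/-- The Conway–Sloane tetralattice pairs are non-isometric: for `0 < a < b < c < d`
there is no ℤ-linear bijection `L₁ → L₂` preserving the bilinear form `B`. -/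
theorem conway_sloane_nonisometric (a b c d : ℝ)
    (ha : 0 < a) (hab : a < b) (hbc : b < c) (hcd : c < d) :
    ¬ ∃ f : L1 ≃ₗ[ℤ] L2, ∀ x y : L1,
        B a b c d ((f x : Fin 4 → ℤ)) ((f y : Fin 4 → ℤ)) =
          B a b c d ((x : Fin 4 → ℤ)) ((y : Fin 4 → ℤ)) := by
  rintro ⟨f, hf⟩
  have hmono : StrictMono ![a, b, c, d] := by
    simp [Fin.strictMono_iff_lt_succ, Fin.forall_fin_succ, hab, hbc, hcd]
  have hD (i) : 0 < ![a, b, c, d] i := ha.trans_le (hmono.monotone (Fin.zero_le i))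
  have hf : IsIsometry ![a, b, c, d] f := by
    simp only [IsIsometry, Fin.sum_univ_four]
    exact hf
  rcases le_total 0 (transition f 0 0) with h0 | h0
  · exact not_isTransition search_eq_true _ _ (hf.isTransition hD hmono h0)
  · refine not_isTransition search_eq_true _ _ (hf.neg.isTransition hD hmono ?_)
    simpa [transition] using h0
end

section
/- For all real numbers a, b, c, d and every real number r, there is a bijection between the sets {x ∈ L₁ : Q(x) = r} and {x ∈ L₂ : Q(x) = r}; in particular L₁ and L₂ are isospectral. -/
theorem mem_L1_iff (x : Fin 4 → ℤ) :
    x ∈ L1 ↔ 2 ∣ x 0 + x 1 ∧ 2 ∣ x 1 + x 2 ∧ 4 ∣ x 0 + x 1 + x 2 - x 3 ∧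
      3 ∣ x 0 + x 1 + x 3 ∧ 3 ∣ x 0 + x 2 - x 3 := by
  simp only [L1, Submodule.mem_span_insert, Submodule.mem_span_singleton]
  constructor
  · rintro ⟨p, _, ⟨q, _, ⟨r, _, ⟨s, rfl⟩, rfl⟩, rfl⟩, rfl⟩
    simp [l0, l1, l2, l3]
    omega
  · rintro ⟨h₁, h₂, h₃, h₄, h₅⟩
    refine ⟨(3 * x 0 + 3 * x 1 + 3 * x 2 + x 3) / 4, _,
      ⟨(3 * x 0 + x 1 + x 2 + x 3) / 4, _,
        ⟨(x 0 + x 1 + 3 * x 2 + x 3) / 12, _,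
          ⟨(-5 * x 0 - 3 * x 1 - 5 * x 2 - x 3) / 12, rfl⟩, rfl⟩, rfl⟩, ?_⟩
    ext i
    fin_cases i <;> simp [l0, l1, l2, l3] <;> omega

theorem mem_L2_iff (x : Fin 4 → ℤ) :
    x ∈ L2 ↔ 2 ∣ x 0 + x 1 ∧ 2 ∣ x 1 + x 2 ∧ 4 ∣ x 0 + x 1 + x 2 - x 3 ∧
      3 ∣ x 1 + x 2 + x 3 ∧ 3 ∣ x 0 + x 2 - x 3 := by
  simp only [L2, Submodule.mem_span_insert, Submodule.mem_span_singleton]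
  constructor
  · rintro ⟨p, _, ⟨q, _, ⟨r, _, ⟨s, rfl⟩, rfl⟩, rfl⟩, rfl⟩
    simp [l0, l1, l2, l3]
    omega
  · rintro ⟨h₁, h₂, h₃, h₄, h₅⟩
    refine ⟨(3 * x 0 + 3 * x 1 + 3 * x 2 + x 3) / 4, _,
      ⟨(3 * x 0 + x 1 + x 2 + x 3) / 12, _,
        ⟨(x 0 + x 1 + 3 * x 2 + x 3) / 4, _,
          ⟨(-5 * x 0 - 3 * x 1 - 5 * x 2 - x 3) / 12, rfl⟩, rfl⟩, rfl⟩, ?_⟩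
    ext i
    fin_cases i <;> simp [l0, l1, l2, l3] <;> omega

/-- Unless `3 ∣ x 1`, negate `x 1` together with one further coordinate, chosen to be divisible
by `3` if possible. Modulo `3`, on `L1` and on `L2`, this only changes the sign of `x 1`. -/
def signFlip (x : Fin 4 → ℤ) : Fin 4 → ℤ :=
  if 3 ∣ x 1 then x
  else if 3 ∣ x 0 then ![-x 0, -x 1, x 2, x 3]
  else if 3 ∣ x 2 then ![x 0, -x 1, -x 2, x 3]
  else ![x 0, -x 1, x 2, -x 3]

theorem signFlip_involutive : Function.Involutive signFlip := by
  intro x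
  ext i
  by_cases h₁ : 3 ∣ x 1 <;> by_cases h₀ : 3 ∣ x 0 <;> by_cases h₂ : 3 ∣ x 2 <;>
    fin_cases i <;> simp [signFlip, h₁, h₀, h₂]

theorem Q_signFlip (a b c d : ℝ) (x : Fin 4 → ℤ) : Q a b c d (signFlip x) = Q a b c d x := by
  unfold signFlip
  split_ifs <;> simp [Q]

theorem signFlip_mem_L2_iff (x : Fin 4 → ℤ) : signFlip x ∈ L2 ↔ x ∈ L1 := by
  rw [mem_L1_iff, mem_L2_iff]
  have h₀ : x 0 % 3 = 0 ∨ x 0 % 3 = 1 ∨ x 0 % 3 = 2 := by omega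
  have h₂ : x 2 % 3 = 0 ∨ x 2 % 3 = 1 ∨ x 2 % 3 = 2 := by omega
  unfold signFlip
  split_ifs <;> simp <;> omega

/-- `L₁` and `L₂` are isospectral: for every `r`, the sets of vectors of square norm `r`
in `L₁` and in `L₂` are in bijection. -/
theorem conway_sloane_isospectral (a b c d : ℝ) (r : ℝ) :
    Nonempty ({x : Fin 4 → ℤ // x ∈ L1 ∧ Q a b c d x = r} ≃
      {x : Fin 4 → ℤ // x ∈ L2 ∧ Q a b c d x = r}) :=
  ⟨signFlip_involutive.toPerm.subtypeEquiv fun x => by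
    simp [signFlip_mem_L2_iff, Q_signFlip]⟩
end

section
/- For all real numbers a, b, c, d with 0 < a < b < c < d, all τ ∈ ℂ with Im τ > 0, and every v ∈ {0, ±v₀, ±v₁, ±v₂, ±v₃}: Σ_{(m,m') ∈ M×M} (B(m+v, m'+v)² − B(Ψ(m+v), Ψ(m'+v))²)·q^{Q(m+v)+Q(m'+v)} = 0; that is, δ_{[v],[v]}(τ) = 0. -/
/-- `M = span_ℤ {(−3,3,3,3), (3,−3,3,3), (3,3,−3,3), (3,3,3,−3)}`. -/
def M : Submodule ℤ (Fin 4 → ℤ) :=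
  Submodule.span ℤ {![-3, 3, 3, 3], ![3, -3, 3, 3], ![3, 3, -3, 3], ![3, 3, 3, -3]}

/-- The coset representatives `v₀, v₁, v₂, v₃` of `L₁/M`. -/
def v : Fin 4 → (Fin 4 → ℤ) :=
  ![![-1, 3, -1, 1], ![1, -1, -1, 3], ![3, 1, -1, -1], ![-1, -1, -3, -1]]

/-- The Kleinian four group elements `g₀ = id`, `g₁ = diag(−1,1,−1,1)`,
`g₂ = diag(−1,−1,1,1)`, `g₃ = diag(1,−1,−1,1)` acting diagonally on `ℤ⁴`. -/
def g : Fin 4 → (Fin 4 → ℤ) → (Fin 4 → ℤ) :=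
  ![fun x => x,
    fun x => ![-(x 0), x 1, -(x 2), x 3],
    fun x => ![-(x 0), -(x 1), x 2, x 3],
    fun x => ![x 0, -(x 1), -(x 2), x 3]]

open Classical in
/-- The Conway–Sloane bijection `Ψ : L₁ → L₂`, given by `Ψ(m) = m` for `m ∈ M` and
`Ψ(m ± vᵢ) = gᵢ(m ± vᵢ)`  (note `g₀ = id`, so the classes `[0], [±v₀]` are fixed). -/
noncomputable def Psi (x : Fin 4 → ℤ) : Fin 4 → ℤ :=
  if x - v 1 ∈ M ∨ x + v 1 ∈ M then g 1 x
  else if x - v 2 ∈ M ∨ x + v 2 ∈ M then g 2 x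
  else if x - v 3 ∈ M ∨ x + v 3 ∈ M then g 3 x
  else x

/-- `q^r := exp(2πiτr)`. -/
noncomputable def qpow (τ : ℂ) (r : ℝ) : ℂ :=
  Complex.exp (2 * Real.pi * Complex.I * τ * (r : ℂ))

/-- Each `gᵢ` is an isometry for the bilinear form `B`. -/
theorem B_g (a b c d : ℝ) (i : Fin 4) (x y : Fin 4 → ℤ) :
    B a b c d (g i x) (g i y) = B a b c d x y := by
  fin_cases i <;> simp [B, g]

/-- `Ψ` acts on each class modulo `M` by a single `gᵢ`, so it preserves `B` within a class. -/
theorem B_Psi_of_sub_mem (a b c d : ℝ) {x y : Fin 4 → ℤ} (h : x - y ∈ M) :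
    B a b c d (Psi x) (Psi y) = B a b c d x y := by
  have sub_iff (u : Fin 4 → ℤ) : x - u ∈ M ↔ y - u ∈ M := by
    rw [← M.add_mem_iff_right h (y := y - u), sub_add_sub_cancel]
  have add_iff (u : Fin 4 → ℤ) : x + u ∈ M ↔ y + u ∈ M := by
    simpa using sub_iff (-u)
  classical
  simp only [Psi, sub_iff, add_iff]
  split_ifs
  · exact B_g a b c d 1 x y
  · exact B_g a b c d 2 x y
  · exact B_g a b c d 3 x y
  · rfl

/-- `δ_{[v],[v]}(τ) = 0` for every class `[v]` of `L₁/M`,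
`v ∈ {0, ±v₀, ±v₁, ±v₂, ±v₃}`. -/
theorem delta_diagonal_vanishes (a b c d : ℝ)
    (ha : 0 < a) (hab : a < b) (hbc : b < c) (hcd : c < d)
    (τ : ℂ) (hτ : 0 < τ.im) (w : Fin 4 → ℤ)
    (hw : w = 0 ∨ w = v 0 ∨ w = -v 0 ∨ w = v 1 ∨ w = -v 1 ∨
          w = v 2 ∨ w = -v 2 ∨ w = v 3 ∨ w = -v 3) :
    ∑' p : M × M,
        (((B a b c d ((p.1 : Fin 4 → ℤ) + w) ((p.2 : Fin 4 → ℤ) + w)) ^ 2 -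
            (B a b c d (Psi ((p.1 : Fin 4 → ℤ) + w)) (Psi ((p.2 : Fin 4 → ℤ) + w))) ^ 2 : ℝ) : ℂ) *
          qpow τ (Q a b c d ((p.1 : Fin 4 → ℤ) + w) + Q a b c d ((p.2 : Fin 4 → ℤ) + w)) = 0 := by
  refine (tsum_congr fun p => ?_).trans tsum_zero
  have h : ((p.1 : Fin 4 → ℤ) + w) - ((p.2 : Fin 4 → ℤ) + w) ∈ M := by
    simpa using M.sub_mem p.1.2 p.2.2
  simp [B_Psi_of_sub_mem a b c d h]
end

section
/- For all real numbers a, b, c, d with 0 < a < b < c < d, all τ ∈ ℂ with Im τ > 0, and every i ∈ {0,1,2,3}: Σ_{(m,m') ∈ M×M} (B(m, m'+vᵢ)² − B(m, gᵢ(m'+vᵢ))²)·q^{Q(m)+Q(m'+vᵢ)} = 0; that is, δ_{[0],[vᵢ]}(τ) = 0. -/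
theorem g_involutive (i : Fin 4) : Function.Involutive (g i) := by
  intro x
  fin_cases i <;> ext j <;> fin_cases j <;> simp [g]

theorem g_add (i : Fin 4) (x y : Fin 4 → ℤ) : g i (x + y) = g i x + g i y := by
  fin_cases i <;> ext j <;> fin_cases j <;> simp [g] <;> ring

theorem g_smul (i : Fin 4) (n : ℤ) (x : Fin 4 → ℤ) : g i (n • x) = n • g i x := by
  fin_cases i <;> ext j <;> fin_cases j <;> simp [g]

/-- The lattice `M` is stable under the Kleinian four group: each `gᵢ` permutes the generators of
`M` up to sign. -/
theorem g_mem_M (i : Fin 4) {x : Fin 4 → ℤ} (hx : x ∈ M) : g i x ∈ M := by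
  have h0 : ![-3, 3, 3, 3] ∈ M := Submodule.subset_span (by simp)
  have h1 : ![3, -3, 3, 3] ∈ M := Submodule.subset_span (by simp)
  have h2 : ![3, 3, -3, 3] ∈ M := Submodule.subset_span (by simp)
  have h3 : ![3, 3, 3, -3] ∈ M := Submodule.subset_span (by simp)
  have n0 := M.neg_mem h0
  have n1 := M.neg_mem h1
  have n2 := M.neg_mem h2
  have n3 := M.neg_mem h3
  simp only [Matrix.neg_cons, neg_neg, Matrix.neg_empty] at n0 n1 n2 n3
  induction hx using Submodule.span_induction with
  | mem x hx =>
    simp only [Set.mem_insert_iff, Set.mem_singleton_iff] at hx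
    rcases hx with rfl | rfl | rfl | rfl <;> fin_cases i <;> simpa [g]
  | zero =>
    have h : g i 0 = 0 := by simpa using g_smul i 0 0
    simp [h]
  | add x y _ _ hx hy => exact g_add i x y ▸ M.add_mem hx hy
  | smul n x _ hx => exact g_smul i n x ▸ M.smul_mem n hx

/-- The action of `gᵢ` on `M`, as a permutation. -/
def gPerm (i : Fin 4) : Equiv.Perm M :=
  Function.Involutive.toPerm (fun x => ⟨g i x, g_mem_M i x.2⟩)
    fun x => Subtype.ext (g_involutive i x)

@[simp]
theorem coe_gPerm (i : Fin 4) (x : M) : (gPerm i x : Fin 4 → ℤ) = g i x := rfl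

theorem Q_g (a b c d : ℝ) (i : Fin 4) (x : Fin 4 → ℤ) : Q a b c d (g i x) = Q a b c d x := by
  fin_cases i <;> simp [Q, g]

/-- Averaging `B(m, y)²` over the Kleinian four group acting on `m` leaves only the diagonal
terms. -/
theorem sum_B_g_sq (a b c d : ℝ) (x y : Fin 4 → ℤ) :
    ∑ k, B a b c d (g k x) y ^ 2 =
      4 * ((a * x 0 * y 0) ^ 2 + (b * x 1 * y 1) ^ 2 + (c * x 2 * y 2) ^ 2 +
        (d * x 3 * y 3) ^ 2) := by
  simp [Fin.sum_univ_four, B, g]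
  ring

theorem sum_B_g_sq_g (a b c d : ℝ) (i : Fin 4) (x y : Fin 4 → ℤ) :
    ∑ k, B a b c d (g k x) (g i y) ^ 2 = ∑ k, B a b c d (g k x) y ^ 2 := by
  rw [sum_B_g_sq, sum_B_g_sq]
  fin_cases i <;> simp [g]

/-- A sum over a type vanishes if the summand cancels over the orbits of finitely many
permutations. -/
theorem tsum_eq_zero_of_sum_perm {ι κ : Type*} [Fintype κ] [Nonempty κ] (e : κ → Equiv.Perm ι)
    (f : ι → ℂ) (h : ∀ x, ∑ k, f (e k x) = 0) : ∑' x, f x = 0 := by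
  by_cases hf : Summable f
  · have key : ∑ k : κ, ∑' x, f (e k x) = 0 := by
      rw [← Summable.tsum_finsetSum fun k _ => show Summable fun x => f (e k x) from
        (e k).summable_iff.mpr hf]
      simp [h]
    simpa [fun k => (e k).tsum_eq f] using key
  · exact tsum_eq_zero_of_not_summable hf

/-- `δ_{[0],[vᵢ]}(τ) = 0` for every `i ∈ {0,1,2,3}`. -/
theorem delta_zero_class_vanishes (a b c d : ℝ)
    (ha : 0 < a) (hab : a < b) (hbc : b < c) (hcd : c < d)
    (τ : ℂ) (hτ : 0 < τ.im) (i : Fin 4) :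
    ∑' p : M × M,
        (((B a b c d (p.1 : Fin 4 → ℤ) ((p.2 : Fin 4 → ℤ) + v i)) ^ 2 -
            (B a b c d (p.1 : Fin 4 → ℤ) (g i ((p.2 : Fin 4 → ℤ) + v i))) ^ 2 : ℝ) : ℂ) *
          qpow τ (Q a b c d (p.1 : Fin 4 → ℤ) + Q a b c d ((p.2 : Fin 4 → ℤ) + v i)) = 0 := by
  refine tsum_eq_zero_of_sum_perm (fun k => (gPerm k).prodCongr (Equiv.refl M)) _ fun p => ?_
  simp only [Equiv.prodCongr_apply, Prod.map_fst, Prod.map_snd, Equiv.refl_apply, coe_gPerm, Q_g]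
  rw [← Finset.sum_mul, ← Complex.ofReal_sum, Finset.sum_sub_distrib, sum_B_g_sq_g]
  simp
end

section
/- For all n = (n₀,n₁,n₂,n₃) and n' = (n'₀,n'₁,n'₂,n'₃) in ℕ⁴: n ≺ n' if and only if for all real numbers a, b, c, d with 0 < a < b < c < d one has a·n₀ + b·n₁ + c·n₂ + d·n₃ < a·n'₀ + b·n'₁ + c·n'₂ + d·n'₃. -/
/-- The partial preorder `≼` on `ℕ⁴`: `n ≼ n'` iff the partial sums from the top
coordinate dominate, i.e. `Σ_{i ≥ i₀} nᵢ ≤ Σ_{i ≥ i₀} n'ᵢ` for every `i₀`. -/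
def preceq (n n' : Fin 4 → ℕ) : Prop :=
  ∀ i0 : Fin 4, ∑ i ∈ Finset.univ.filter (fun i => i0 ≤ i), n i ≤
    ∑ i ∈ Finset.univ.filter (fun i => i0 ≤ i), n' i

/-- The strict relation `≺`: `n ≺ n'` iff `n ≼ n'` but not `n' ≼ n`. -/
def precl (n n' : Fin 4 → ℕ) : Prop := preceq n n' ∧ ¬ preceq n' n

theorem preceq_iff (n n' : Fin 4 → ℕ) : preceq n n' ↔
    n 0 + n 1 + n 2 + n 3 ≤ n' 0 + n' 1 + n' 2 + n' 3 ∧ n 1 + n 2 + n 3 ≤ n' 1 + n' 2 + n' 3 ∧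
      n 2 + n 3 ≤ n' 2 + n' 3 ∧ n 3 ≤ n' 3 := by
  simp only [preceq, Finset.sum_filter, Fin.sum_univ_four, Fin.forall_fin_succ]
  simp

/-- A negative integer difference with weight `t + 1` outweighs a contribution of `t`. -/
theorem le_of_lt_add_mul_sub {p q : ℕ} {t : ℝ} (ht : 0 ≤ t)
    (h : 0 < t + (t + 1) * ((q : ℝ) - p)) : p ≤ q := by
  by_contra! hlt
  have hlt' : (q : ℝ) + 1 ≤ p := by exact_mod_cast hlt
  nlinarith

/-- `n ≺ n'` iff `a n₀ + b n₁ + c n₂ + d n₃ < a n'₀ + b n'₁ + c n'₂ + d n'₃` for all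
real `0 < a < b < c < d`. -/
theorem precl_iff_forall_lt (n n' : Fin 4 → ℕ) :
    precl n n' ↔ ∀ a b c d : ℝ, 0 < a → a < b → b < c → c < d →
      a * n 0 + b * n 1 + c * n 2 + d * n 3 <
        a * n' 0 + b * n' 1 + c * n' 2 + d * n' 3 := by
  rw [precl, preceq_iff, preceq_iff]
  constructor
  · rintro ⟨⟨h0, h1, h2, h3⟩, hne⟩ a b c d ha hab hbc hcd
    have hlt : n 0 + n 1 + n 2 + n 3 < n' 0 + n' 1 + n' 2 + n' 3 ∨
        n 1 + n 2 + n 3 < n' 1 + n' 2 + n' 3 ∨ n 2 + n 3 < n' 2 + n' 3 ∨ n 3 < n' 3 := by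
      omega
    rify at h0 h1 h2 h3 hlt
    have m0 := mul_le_mul_of_nonneg_left h0 ha.le
    have m1 := mul_le_mul_of_nonneg_left h1 (sub_pos.2 hab).le
    have m2 := mul_le_mul_of_nonneg_left h2 (sub_pos.2 hbc).le
    have m3 := mul_le_mul_of_nonneg_left h3 (sub_pos.2 hcd).le
    rcases hlt with h | h | h | h
    · linarith [mul_lt_mul_of_pos_left h ha]
    · linarith [mul_lt_mul_of_pos_left h (sub_pos.2 hab)]
    · linarith [mul_lt_mul_of_pos_left h (sub_pos.2 hbc)]
    · linarith [mul_lt_mul_of_pos_left h (sub_pos.2 hcd)]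
  · intro h
    obtain ⟨t, ht⟩ : ∃ t : ℝ, t = 3 * (n' 0 + n' 1 + n' 2 + n' 3) := ⟨_, rfl⟩
    have ht0 : 0 ≤ t := by rw [ht]; positivity
    have hn (i : Fin 4) : (0 : ℝ) ≤ n i := Nat.cast_nonneg _
    have hn' (i : Fin 4) : (0 : ℝ) ≤ n' i := Nat.cast_nonneg _
    have p0 := hn 0
    have p1 := hn 1
    have p2 := hn 2
    have p3 := hn 3
    have q0 := hn' 0
    have q1 := hn' 1
    have q2 := hn' 2
    have q3 := hn' 3
    refine ⟨⟨?_, ?_, ?_, ?_⟩, fun ⟨h0, h1, h2, h3⟩ => ?_⟩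
    · refine le_of_lt_add_mul_sub ht0 ?_
      push_cast
      linarith [h (t + 1) (t + 2) (t + 3) (t + 4) (by linarith) (by linarith) (by linarith)
        (by linarith)]
    · refine le_of_lt_add_mul_sub ht0 ?_
      push_cast
      linarith [h 1 (t + 2) (t + 3) (t + 4) (by linarith) (by linarith) (by linarith)
        (by linarith)]
    · refine le_of_lt_add_mul_sub ht0 ?_
      push_cast
      linarith [h 1 2 (t + 3) (t + 4) (by linarith) (by linarith) (by linarith) (by linarith)]
    · refine le_of_lt_add_mul_sub ht0 ?_
      linarith [h 1 2 3 (t + 4) (by linarith) (by linarith) (by linarith) (by linarith)]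
    · have := h 1 2 3 4 (by norm_num) (by norm_num) (by norm_num) (by norm_num)
      rify at h0 h1 h2 h3
      linarith
end

section
/- An element w of the coset v₀ + M is minimal with respect to ≺ (i.e., there is no w' ∈ v₀ + M with w' ≺ w) if and only if w = v₀ = (−1,3,−1,1) or w = v₄ = (−4,0,2,−2). -/
/-- `φ : ℤ⁴ → ℕ⁴`, `φ(x) = (x₀², x₁², x₂², x₃²)`. -/
def phi (x : Fin 4 → ℤ) : Fin 4 → ℕ := fun i => (x i).natAbs ^ 2

/-- Coordinates of the elements of the coset `v₀ + M`. -/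
lemma coset_coords {w : Fin 4 → ℤ} (hw : w - v 0 ∈ M) :
    ∃ a b c d : ℤ, w 0 = -1 + 3 * (-a + b + c + d) ∧ w 1 = 3 + 3 * (a - b + c + d) ∧
      w 2 = -1 + 3 * (a + b - c + d) ∧ w 3 = 1 + 3 * (a + b + c - d) := by
  simp only [M, Submodule.mem_span_insert, Submodule.mem_span_singleton] at hw
  obtain ⟨a, _, ⟨b, _, ⟨c, _, ⟨d, rfl⟩, rfl⟩, rfl⟩, h⟩ := hw
  have h0 := congrFun h 0
  have h1 := congrFun h 1
  have h2 := congrFun h 2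
  have h3 := congrFun h 3
  simp [v] at h0 h1 h2 h3
  exact ⟨a, b, c, d, by omega, by omega, by omega, by omega⟩

lemma preceq_phi_iff (x y : Fin 4 → ℤ) :
    preceq (phi x) (phi y) ↔
      x 0 ^ 2 + x 1 ^ 2 + x 2 ^ 2 + x 3 ^ 2 ≤ y 0 ^ 2 + y 1 ^ 2 + y 2 ^ 2 + y 3 ^ 2 ∧
      x 1 ^ 2 + x 2 ^ 2 + x 3 ^ 2 ≤ y 1 ^ 2 + y 2 ^ 2 + y 3 ^ 2 ∧
      x 2 ^ 2 + x 3 ^ 2 ≤ y 2 ^ 2 + y 3 ^ 2 ∧ x 3 ^ 2 ≤ y 3 ^ 2 := by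
  simp only [preceq, Fin.forall_fin_succ, Finset.sum_filter, Fin.sum_univ_four, phi]
  zify
  simp [sq_abs, Fin.le_def]

lemma sq_le_sq_of_le_or_le_neg {x m : ℤ} (hm : 0 ≤ m) (h : m ≤ x ∨ x ≤ -m) :
    m ^ 2 ≤ x ^ 2 := by
  rcases h with h | h <;> nlinarith

lemma v_zero_sub_mem : v 0 - v 0 ∈ M := by simp

lemma neg_four_zero_two_neg_two_sub_mem : (![-4, 0, 2, -2] : Fin 4 → ℤ) - v 0 ∈ M := by
  have h : (![-4, 0, 2, -2] : Fin 4 → ℤ) - v 0 = -![3, 3, -3, 3] := by decide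
  rw [h]
  exact M.neg_mem (Submodule.subset_span (by simp))

lemma preceq_v_zero_or_preceq {w : Fin 4 → ℤ} (hw : w - v 0 ∈ M) :
    preceq (phi (v 0)) (phi w) ∨ preceq (phi ![-4, 0, 2, -2]) (phi w) := by
  obtain ⟨a, b, c, d, h0, h1, h2, h3⟩ := coset_coords hw
  simp only [preceq_phi_iff]
  simp [v, -one_le_sq_iff_one_le_abs]
  by_cases hz : w 1 = 0
  · right
    have s2 := sq_le_sq_of_le_or_le_neg (x := w 2) (m := 2) (by norm_num) (by omega)
    have s3 := sq_le_sq_of_le_or_le_neg (x := w 3) (m := 2) (by norm_num) (by omega)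
    have s0 := sq_le_sq_of_le_or_le_neg (x := w 0) (m := 2) (by norm_num) (by omega)
    have s : 4 ^ 2 ≤ w 0 ^ 2 ∨ 4 ^ 2 ≤ w 2 ^ 2 ∨ 4 ^ 2 ≤ w 3 ^ 2 := by
      have : (4 ≤ w 0 ∨ w 0 ≤ -4) ∨ (4 ≤ w 2 ∨ w 2 ≤ -4) ∨ (4 ≤ w 3 ∨ w 3 ≤ -4) := by omega
      exact this.imp (sq_le_sq_of_le_or_le_neg (by norm_num))
        (Or.imp (sq_le_sq_of_le_or_le_neg (by norm_num)) (sq_le_sq_of_le_or_le_neg (by norm_num)))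
    rw [hz]
    omega
  · left
    have s0 := sq_le_sq_of_le_or_le_neg (x := w 0) (m := 1) (by norm_num) (by omega)
    have s1 := sq_le_sq_of_le_or_le_neg (x := w 1) (m := 3) (by norm_num) (by omega)
    have s2 := sq_le_sq_of_le_or_le_neg (x := w 2) (m := 1) (by norm_num) (by omega)
    have s3 := sq_le_sq_of_le_or_le_neg (x := w 3) (m := 1) (by norm_num) (by omega)
    omega

lemma sq_eq_of_preceq_preceq {x y : Fin 4 → ℤ} (hxy : preceq (phi x) (phi y))
    (hyx : preceq (phi y) (phi x)) (i : Fin 4) : x i = y i ∨ x i = -y i := by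
  rw [preceq_phi_iff] at hxy hyx
  rw [← sq_eq_sq_iff_eq_or_eq_neg]
  fin_cases i <;> simp <;> omega

lemma eq_v_zero_of_preceq {w : Fin 4 → ℤ} (hw : w - v 0 ∈ M)
    (h : preceq (phi (v 0)) (phi w)) (h' : preceq (phi w) (phi (v 0))) : w = v 0 := by
  obtain ⟨a, b, c, d, h0, h1, h2, h3⟩ := coset_coords hw
  have e := sq_eq_of_preceq_preceq h' h
  simp [Fin.forall_fin_succ, v] at e
  ext i
  fin_cases i <;> simp [v] <;> omega

lemma eq_of_preceq {w : Fin 4 → ℤ} (hw : w - v 0 ∈ M)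
    (h : preceq (phi ![-4, 0, 2, -2]) (phi w)) (h' : preceq (phi w) (phi ![-4, 0, 2, -2])) :
    w = ![-4, 0, 2, -2] := by
  obtain ⟨a, b, c, d, h0, h1, h2, h3⟩ := coset_coords hw
  have e := sq_eq_of_preceq_preceq h' h
  simp [Fin.forall_fin_succ] at e
  ext i
  fin_cases i <;> simp <;> omega

lemma preceq_trans {x y z : Fin 4 → ℕ} (hxy : preceq x y) (hyz : preceq y z) : preceq x z :=
  fun i => (hxy i).trans (hyz i)

lemma not_preceq_v_zero : ¬ preceq (phi ![-4, 0, 2, -2]) (phi (v 0)) := by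
  simp [preceq_phi_iff, v]

lemma v_zero_not_preceq : ¬ preceq (phi (v 0)) (phi ![-4, 0, 2, -2]) := by
  simp [preceq_phi_iff, v]

/-- The minimal vectors of the coset `v₀ + M` with respect to `≺` are exactly
`v₀ = (−1,3,−1,1)` and `v₄ = (−4,0,2,−2)`. -/
theorem minimal_vectors_class_v0 (w : Fin 4 → ℤ) (hw : w - v 0 ∈ M) :
    (¬ ∃ w' : Fin 4 → ℤ, w' - v 0 ∈ M ∧ precl (phi w') (phi w)) ↔
      (w = v 0 ∨ w = ![-4, 0, 2, -2]) := by
  constructor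
  · intro hmin
    rcases preceq_v_zero_or_preceq hw with h | h
    · exact .inl (eq_v_zero_of_preceq hw h
        (by_contra fun h' => hmin ⟨_, v_zero_sub_mem, h, h'⟩))
    · exact .inr (eq_of_preceq hw h
        (by_contra fun h' => hmin ⟨_, neg_four_zero_two_neg_two_sub_mem, h, h'⟩))
  · rintro (rfl | rfl) ⟨w', hw', hle, hnle⟩
    · exact (preceq_v_zero_or_preceq hw').elim hnle
        fun h => not_preceq_v_zero (preceq_trans h hle)
    · exact (preceq_v_zero_or_preceq hw').elim
        (fun h => v_zero_not_preceq (preceq_trans h hle)) hnle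
end

section
/- Let 0 ≤ i < j ≤ 3, let v ∈ vᵢ + M and v' ∈ vⱼ + M, and suppose (v, v') ≠ (v₀, v₂) and (v, v') ≠ (v₅, v₂), where v₅ = (4,2,2,0). Then for all real numbers a, b, c, d with 0 < a < b < c < d: Q(v) + Q(v') > min(Q(v₀) + Q(v₂), Q(v₅) + Q(v₂)). -/
theorem exists_coords_of_mem_M {x : Fin 4 → ℤ} (hx : x ∈ M) :
    ∃ p q r s : ℤ, x 0 = 3 * (-p + q + r + s) ∧ x 1 = 3 * (p - q + r + s) ∧
      x 2 = 3 * (p + q - r + s) ∧ x 3 = 3 * (p + q + r - s) := by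
  simp only [M, Submodule.mem_span_insert, Submodule.mem_span_singleton] at hx
  obtain ⟨p, _, ⟨q, _, ⟨r, _, ⟨s, rfl⟩, rfl⟩, rfl⟩, rfl⟩ := hx
  refine ⟨p, q, r, s, ?_, ?_, ?_, ?_⟩ <;> simp <;> ring

/-- Either an integer is the smallest representative of its class modulo `6` (up to sign for the
class of `3`, and allowing both `-2` and `4` for the class of `4`), or its square is at least the
next possible value. -/
theorem sq_bounds_mod_six (x : ℤ) :
    (x % 6 = 0 → x = 0 ∧ x ^ 2 = 0 ∨ 36 ≤ x ^ 2) ∧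
    (x % 6 = 1 → x = 1 ∧ x ^ 2 = 1 ∨ 25 ≤ x ^ 2) ∧
    (x % 6 = 2 → x = 2 ∧ x ^ 2 = 4 ∨ 16 ≤ x ^ 2) ∧
    (x % 6 = 3 → (x = 3 ∨ x = -3) ∧ x ^ 2 = 9 ∨ 81 ≤ x ^ 2) ∧
    (x % 6 = 4 → x = -2 ∧ x ^ 2 = 4 ∨ x = 4 ∧ x ^ 2 = 16 ∨ 64 ≤ x ^ 2) ∧
    (x % 6 = 5 → x = -1 ∧ x ^ 2 = 1 ∨ 25 ≤ x ^ 2) := by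
  have key (k : ℤ) (hk : 0 ≤ k) (h : x ≤ -k ∨ k ≤ x) : k ^ 2 ≤ x ^ 2 := by
    rcases h with h | h <;> nlinarith
  refine ⟨fun h => ?_, fun h => ?_, fun h => ?_, fun h => ?_, fun h => ?_, fun h => ?_⟩
  · rcases eq_or_ne x 0 with rfl | _
    · simp
    · exact .inr (key 6 (by norm_num) (by omega))
  · rcases eq_or_ne x 1 with rfl | _
    · simp
    · exact .inr (key 5 (by norm_num) (by omega))
  · rcases eq_or_ne x 2 with rfl | _
    · simp
    · exact .inr (key 4 (by norm_num) (by omega))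
  · rcases eq_or_ne x 3 with rfl | _
    · simp
    · rcases eq_or_ne x (-3) with rfl | _
      · simp
      · exact .inr (key 9 (by norm_num) (by omega))
  · rcases eq_or_ne x (-2) with rfl | _
    · simp
    · rcases eq_or_ne x 4 with rfl | _
      · simp
      · exact .inr (.inr (key 8 (by norm_num) (by omega)))
  · rcases eq_or_ne x (-1) with rfl | _
    · simp
    · exact .inr (key 5 (by norm_num) (by omega))

/-- The tail sums `x₀² + x₁² + x₂² + x₃²`, `x₁² + x₂² + x₃²`, `x₂² + x₃²`, `x₃²` are bounded below
by `t₀`, `t₁`, `t₂`, `t₃`. -/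
def TailsGE (x : Fin 4 → ℤ) (t₀ t₁ t₂ t₃ : ℤ) : Prop :=
  t₀ ≤ x 0 ^ 2 + x 1 ^ 2 + x 2 ^ 2 + x 3 ^ 2 ∧ t₁ ≤ x 1 ^ 2 + x 2 ^ 2 + x 3 ^ 2 ∧
    t₂ ≤ x 2 ^ 2 + x 3 ^ 2 ∧ t₃ ≤ x 3 ^ 2

theorem eq_vec_of_coords {x : Fin 4 → ℤ} {p q r s : ℤ} (h0 : x 0 = p) (h1 : x 1 = q)
    (h2 : x 2 = r) (h3 : x 3 = s) : x = ![p, q, r, s] := by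
  subst h0 h1 h2 h3
  ext k
  fin_cases k <;> rfl

theorem coset_zero {x : Fin 4 → ℤ} (hx : x - v 0 ∈ M) :
    x = v 0 ∨ TailsGE x 24 8 8 4 ∨ TailsGE x 13 11 2 1 := by
  obtain ⟨p, q, r, s, h0, h1, h2, h3⟩ := exists_coords_of_mem_M hx
  simp [v] at h0 h1 h2 h3
  have b0 := sq_bounds_mod_six (x 0)
  have b1 := sq_bounds_mod_six (x 1)
  have b2 := sq_bounds_mod_six (x 2)
  have b3 := sq_bounds_mod_six (x 3)
  by_cases hv : x 0 = -1 ∧ x 1 = 3 ∧ x 2 = -1 ∧ x 3 = 1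
  · exact .inl (eq_vec_of_coords hv.1 hv.2.1 hv.2.2.1 hv.2.2.2)
  right
  unfold TailsGE
  generalize x 0 ^ 2 = y0 at *
  generalize x 1 ^ 2 = y1 at *
  generalize x 2 ^ 2 = y2 at *
  generalize x 3 ^ 2 = y3 at *
  rcases Int.emod_two_eq_zero_or_one (p + q + r + s) with hp | hp
  · have b0 := b0.2.2.2.2.2 (by omega)
    have b1 := b1.2.2.2.1 (by omega)
    have b2 := b2.2.2.2.2.2 (by omega)
    have b3 := b3.2.1 (by omega)
    omega
  · have b0 := b0.2.2.1 (by omega)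
    have b1 := b1.1 (by omega)
    have b2 := b2.2.2.1 (by omega)
    have b3 := b3.2.2.2.2.1 (by omega)
    omega

theorem coset_one {x : Fin 4 → ℤ} (hx : x - v 1 ∈ M) :
    x = ![4, 2, 2, 0] ∨ TailsGE x 12 11 10 9 ∨ TailsGE x 25 8 4 0 ∨ TailsGE x 24 20 4 0 := by
  obtain ⟨p, q, r, s, h0, h1, h2, h3⟩ := exists_coords_of_mem_M hx
  simp [v] at h0 h1 h2 h3
  have b0 := sq_bounds_mod_six (x 0)
  have b1 := sq_bounds_mod_six (x 1)
  have b2 := sq_bounds_mod_six (x 2)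
  have b3 := sq_bounds_mod_six (x 3)
  by_cases hv : x 0 = 4 ∧ x 1 = 2 ∧ x 2 = 2 ∧ x 3 = 0
  · exact .inl (eq_vec_of_coords hv.1 hv.2.1 hv.2.2.1 hv.2.2.2)
  right
  unfold TailsGE
  generalize x 0 ^ 2 = y0 at *
  generalize x 1 ^ 2 = y1 at *
  generalize x 2 ^ 2 = y2 at *
  generalize x 3 ^ 2 = y3 at *
  rcases Int.emod_two_eq_zero_or_one (p + q + r + s) with hp | hp
  · have b0 := b0.2.1 (by omega)
    have b1 := b1.2.2.2.2.2 (by omega)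
    have b2 := b2.2.2.2.2.2 (by omega)
    have b3 := b3.2.2.2.1 (by omega)
    omega
  · have b0 := b0.2.2.2.2.1 (by omega)
    have b1 := b1.2.2.1 (by omega)
    have b2 := b2.2.2.1 (by omega)
    have b3 := b3.1 (by omega)
    omega

theorem coset_two {x : Fin 4 → ℤ} (hx : x - v 2 ∈ M) :
    x = v 2 ∨ TailsGE x 13 3 2 1 := by
  obtain ⟨p, q, r, s, h0, h1, h2, h3⟩ := exists_coords_of_mem_M hx
  simp [v] at h0 h1 h2 h3
  have b0 := sq_bounds_mod_six (x 0)
  have b1 := sq_bounds_mod_six (x 1)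
  have b2 := sq_bounds_mod_six (x 2)
  have b3 := sq_bounds_mod_six (x 3)
  by_cases hv : x 0 = 3 ∧ x 1 = 1 ∧ x 2 = -1 ∧ x 3 = -1
  · exact .inl (eq_vec_of_coords hv.1 hv.2.1 hv.2.2.1 hv.2.2.2)
  right
  unfold TailsGE
  generalize x 0 ^ 2 = y0 at *
  generalize x 1 ^ 2 = y1 at *
  generalize x 2 ^ 2 = y2 at *
  generalize x 3 ^ 2 = y3 at *
  rcases Int.emod_two_eq_zero_or_one (p + q + r + s) with hp | hp
  · have b0 := b0.2.2.2.1 (by omega)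
    have b1 := b1.2.1 (by omega)
    have b2 := b2.2.2.2.2.2 (by omega)
    have b3 := b3.2.2.2.2.2 (by omega)
    omega
  · have b0 := b0.1 (by omega)
    have b1 := b1.2.2.2.2.1 (by omega)
    have b2 := b2.2.2.1 (by omega)
    have b3 := b3.2.2.1 (by omega)
    omega

theorem coset_three {x : Fin 4 → ℤ} (hx : x - v 3 ∈ M) :
    TailsGE x 24 8 4 4 ∨ TailsGE x 12 11 10 1 := by
  obtain ⟨p, q, r, s, h0, h1, h2, h3⟩ := exists_coords_of_mem_M hx
  simp [v] at h0 h1 h2 h3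
  have b0 := sq_bounds_mod_six (x 0)
  have b1 := sq_bounds_mod_six (x 1)
  have b2 := sq_bounds_mod_six (x 2)
  have b3 := sq_bounds_mod_six (x 3)
  unfold TailsGE
  generalize x 0 ^ 2 = y0 at *
  generalize x 1 ^ 2 = y1 at *
  generalize x 2 ^ 2 = y2 at *
  generalize x 3 ^ 2 = y3 at *
  rcases Int.emod_two_eq_zero_or_one (p + q + r + s) with hp | hp
  · have b0 := b0.2.2.2.2.2 (by omega)
    have b1 := b1.2.2.2.2.2 (by omega)
    have b2 := b2.2.2.2.1 (by omega)
    have b3 := b3.2.2.2.2.2 (by omega)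
    omega
  · have b0 := b0.2.2.1 (by omega)
    have b1 := b1.2.2.1 (by omega)
    have b2 := b2.1 (by omega)
    have b3 := b3.2.2.1 (by omega)
    omega

/-- Summation by parts: a diagonal form with increasing positive coefficients is strictly monotone
in the tail sums. -/
theorem add_lt_add_of_tails {x x' : Fin 4 → ℤ} {y0 y1 y2 y3 : ℤ} {a b c d : ℝ}
    (ha : 0 < a) (hab : a < b) (hbc : b < c) (hcd : c < d)
    (h : 0 ≤ (x 0 ^ 2 + x' 0 ^ 2 - y0) + (x 1 ^ 2 + x' 1 ^ 2 - y1) + (x 2 ^ 2 + x' 2 ^ 2 - y2) +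
        (x 3 ^ 2 + x' 3 ^ 2 - y3) ∧
      0 ≤ (x 1 ^ 2 + x' 1 ^ 2 - y1) + (x 2 ^ 2 + x' 2 ^ 2 - y2) + (x 3 ^ 2 + x' 3 ^ 2 - y3) ∧
      0 ≤ (x 2 ^ 2 + x' 2 ^ 2 - y2) + (x 3 ^ 2 + x' 3 ^ 2 - y3) ∧
      0 ≤ x 3 ^ 2 + x' 3 ^ 2 - y3 ∧
      0 < (x 0 ^ 2 + x' 0 ^ 2 - y0) + 2 * (x 1 ^ 2 + x' 1 ^ 2 - y1) +
        3 * (x 2 ^ 2 + x' 2 ^ 2 - y2) + 4 * (x 3 ^ 2 + x' 3 ^ 2 - y3)) :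
    a * y0 + b * y1 + c * y2 + d * y3 < Q a b c d x + Q a b c d x' := by
  have hQ : Q a b c d x + Q a b c d x' - (a * y0 + b * y1 + c * y2 + d * y3) =
      a * ((x 0 ^ 2 + x' 0 ^ 2 - y0 : ℤ) : ℝ) + b * ((x 1 ^ 2 + x' 1 ^ 2 - y1 : ℤ) : ℝ) +
      c * ((x 2 ^ 2 + x' 2 ^ 2 - y2 : ℤ) : ℝ) + d * ((x 3 ^ 2 + x' 3 ^ 2 - y3 : ℤ) : ℝ) := by
    simp only [Q]
    push_cast
    ring
  rw [← sub_pos, hQ]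
  generalize x 0 ^ 2 + x' 0 ^ 2 - y0 = z0 at *
  generalize x 1 ^ 2 + x' 1 ^ 2 - y1 = z1 at *
  generalize x 2 ^ 2 + x' 2 ^ 2 - y2 = z2 at *
  generalize x 3 ^ 2 + x' 3 ^ 2 - y3 = z3 at *
  obtain ⟨e0, e1, e2, e3, he⟩ := h
  have f0 : (0 : ℝ) ≤ z0 + z1 + z2 + z3 := by exact_mod_cast e0
  have f1 : (0 : ℝ) ≤ z1 + z2 + z3 := by exact_mod_cast e1
  have f2 : (0 : ℝ) ≤ z2 + z3 := by exact_mod_cast e2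
  have f3 : (0 : ℝ) ≤ z3 := by exact_mod_cast e3
  have hf : (0 : ℝ) < z0 + 2 * z1 + 3 * z2 + 4 * z3 := by exact_mod_cast he
  obtain ⟨m, hm, hma, hmb, hmc, hmd⟩ :
      ∃ m : ℝ, 0 < m ∧ m ≤ a ∧ m ≤ b - a ∧ m ≤ c - b ∧ m ≤ d - c :=
    ⟨min (min a (b - a)) (min (c - b) (d - c)), by simp [*], by simp, by simp, by simp, by simp⟩
  nlinarith [mul_pos hm hf, mul_nonneg (sub_nonneg.2 hma) f0, mul_nonneg (sub_nonneg.2 hmb) f1,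
    mul_nonneg (sub_nonneg.2 hmc) f2, mul_nonneg (sub_nonneg.2 hmd) f3]

/-- Any pair of vectors from distinct classes `[vᵢ], [vⱼ]` with `i < j`, other than
`(v₀, v₂)` and `(v₅, v₂)`, has strictly larger total square norm than
`min (Q v₀ + Q v₂) (Q v₅ + Q v₂)`, where `v₅ = (4,2,2,0)`. -/
theorem minimal_pairs (i j : Fin 4) (hij : i < j) (w w' : Fin 4 → ℤ)
    (hw : w - v i ∈ M) (hw' : w' - v j ∈ M)
    (h1 : ¬(w = v 0 ∧ w' = v 2))
    (h2 : ¬(w = ![4, 2, 2, 0] ∧ w' = v 2))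
    (a b c d : ℝ) (ha : 0 < a) (hab : a < b) (hbc : b < c) (hcd : c < d) :
    Q a b c d w + Q a b c d w' >
      min (Q a b c d (v 0) + Q a b c d (v 2))
        (Q a b c d ![4, 2, 2, 0] + Q a b c d (v 2)) := by
  suffices h : a * (10 : ℤ) + b * (10 : ℤ) + c * (2 : ℤ) + d * (2 : ℤ) < Q a b c d w + Q a b c d w' ∨
      a * (25 : ℤ) + b * (5 : ℤ) + c * (5 : ℤ) + d * (1 : ℤ) < Q a b c d w + Q a b c d w' by
    refine min_lt_iff.2 (h.imp (lt_of_eq_of_lt ?_) (lt_of_eq_of_lt ?_)) <;>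
    · simp [Q, v]
      ring
  by_contra hle
  rw [not_or] at hle
  have hA := mt (add_lt_add_of_tails ha hab hbc hcd) hle.1
  have hB := mt (add_lt_add_of_tails ha hab hbc hcd) hle.2
  have hv0 : TailsGE (v 0) 12 11 2 1 := by simp [TailsGE, v]
  have hv2 : TailsGE (v 2) 12 3 2 1 := by simp [TailsGE, v]
  have hv5 : TailsGE ![4, 2, 2, 0] 24 8 4 0 := by simp [TailsGE]
  fin_cases i <;> fin_cases j <;> simp at hij hw hw'
  · rcases coset_zero hw with rfl | hw | hw <;> rcases coset_one hw' with rfl | hw' | hw' | hw' <;>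
      (simp only [TailsGE] at *; omega)
  · rcases coset_zero hw with rfl | hw | hw <;> rcases coset_two hw' with rfl | hw' <;>
      first | exact h1 ⟨rfl, rfl⟩ | (simp only [TailsGE] at *; omega)
  · rcases coset_zero hw with rfl | hw | hw <;> rcases coset_three hw' with hw' | hw' <;>
      (simp only [TailsGE] at *; omega)
  · rcases coset_one hw with rfl | hw | hw | hw <;> rcases coset_two hw' with rfl | hw' <;>
      first | exact h2 ⟨rfl, rfl⟩ | (simp only [TailsGE] at *; omega)
  · rcases coset_one hw with rfl | hw | hw | hw <;> rcases coset_three hw' with hw' | hw' <;>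
      (simp only [TailsGE] at *; omega)
  · rcases coset_two hw with rfl | hw <;> rcases coset_three hw' with hw' | hw' <;>
      (simp only [TailsGE] at *; omega)
end

section
/- The action of the Kleinian four group K₄ on the set of self-dual codes in 𝔽₃⁴ has exactly two orbits: every self-dual code is the image of C₁ = span{(1,0,−1,−1), (0,1,1,−1)} or of C₂ = span{(1,0,−1,1), (0,1,1,1)} under some element of K₄, and no element of K₄ maps C₁ to C₂. -/
/-- A self-dual code in `𝔽₃⁴`: a linear subspace of dimension `2` on which the
standard bilinear form `⟨x,y⟩ = Σᵢ xᵢyᵢ` vanishes identically. -/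
def IsSelfDualCode (C : Submodule (ZMod 3) (Fin 4 → ZMod 3)) : Prop :=
  Module.finrank (ZMod 3) C = 2 ∧ ∀ x ∈ C, ∀ y ∈ C, ∑ i : Fin 4, x i * y i = 0

def g1m : Matrix (Fin 4) (Fin 4) (ZMod 3) :=
  !![0, 0, 1, 0; 0, 0, 0, -1; 1, 0, 0, 0; 0, -1, 0, 0]

def g2m : Matrix (Fin 4) (Fin 4) (ZMod 3) :=
  !![0, 1, 0, 0; 1, 0, 0, 0; 0, 0, 0, -1; 0, 0, -1, 0]

/-- The Kleinian four group `K₄ = {id, g₁, g₂, g₂g₁}`. -/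
def K4 : Set (Matrix (Fin 4) (Fin 4) (ZMod 3)) := {1, g1m, g2m, g2m * g1m}

/-- The image `g(C)` of a code `C` under `g ∈ K₄`. -/
def codeImage (g : Matrix (Fin 4) (Fin 4) (ZMod 3))
    (C : Submodule (ZMod 3) (Fin 4 → ZMod 3)) : Submodule (ZMod 3) (Fin 4 → ZMod 3) :=
  C.map g.mulVecLin

def C1 : Submodule (ZMod 3) (Fin 4 → ZMod 3) :=
  Submodule.span (ZMod 3) {![1, 0, -1, -1], ![0, 1, 1, -1]}

def C2 : Submodule (ZMod 3) (Fin 4 → ZMod 3) :=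
  Submodule.span (ZMod 3) {![1, 0, -1, 1], ![0, 1, 1, 1]}

lemma mem_codeImage_span_pair {g : Matrix (Fin 4) (Fin 4) (ZMod 3)} {r s x : Fin 4 → ZMod 3} :
    x ∈ codeImage g (Submodule.span (ZMod 3) {r, s}) ↔
      ∃ p q : ZMod 3, p • g.mulVec r + q • g.mulVec s = x := by
  simp [codeImage, Submodule.map_span, Set.image_pair, Submodule.mem_span_pair]

lemma finrank_codeImage_span_pair_le (g : Matrix (Fin 4) (Fin 4) (ZMod 3))
    (r s : Fin 4 → ZMod 3) :
    Module.finrank (ZMod 3) (codeImage g (Submodule.span (ZMod 3) {r, s})) ≤ 2 := by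
  classical
  refine (Submodule.finrank_map_le _ _).trans ?_
  have h := finrank_span_finset_le_card (R := ZMod 3) ({r, s} : Finset (Fin 4 → ZMod 3))
  rw [Set.finrank, Finset.coe_pair] at h
  exact h.trans Finset.card_le_two

/-- The projection of a code to its first two coordinates. -/
def codeProj (C : Submodule (ZMod 3) (Fin 4 → ZMod 3)) :
    C →ₗ[ZMod 3] (Fin 2 → ZMod 3) :=
  (LinearMap.funLeft (ZMod 3) (ZMod 3) (Fin.castLE (by decide : 2 ≤ 4))).comp C.subtype

lemma IsSelfDualCode.eq_zero {C : Submodule (ZMod 3) (Fin 4 → ZMod 3)} (hC : IsSelfDualCode C)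
    {x : Fin 4 → ZMod 3} (hx : x ∈ C) (h0 : x 0 = 0) (h1 : x 1 = 0) : x = 0 := by
  have anisotropic : ∀ a b : ZMod 3, a * a + b * b = 0 → a = 0 ∧ b = 0 := by decide
  have h := hC.2 x hx x hx
  simp only [Fin.sum_univ_four, h0, h1, mul_zero, zero_add] at h
  obtain ⟨h2, h3⟩ := anisotropic _ _ h
  ext i
  fin_cases i <;> assumption

lemma IsSelfDualCode.proj_surjective {C : Submodule (ZMod 3) (Fin 4 → ZMod 3)}
    (hC : IsSelfDualCode C) : Function.Surjective (codeProj C) := by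
  have hinj : Function.Injective (codeProj C) := by
    rw [injective_iff_map_eq_zero]
    intro x hx
    exact Subtype.ext (hC.eq_zero x.2 (congrFun hx 0) (congrFun hx 1))
  exact (LinearMap.injective_iff_surjective_of_finrank_eq_finrank (by simp [hC.1])).1 hinj

/-- A self-dual code has a generator matrix in standard form `(I | A)`. -/
lemma IsSelfDualCode.exists_standard_form {C : Submodule (ZMod 3) (Fin 4 → ZMod 3)}
    (hC : IsSelfDualCode C) :
    ∃ a b c d : ZMod 3, C = Submodule.span (ZMod 3) {![1, 0, a, b], ![0, 1, c, d]} ∧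
      1 + a * a + b * b = 0 ∧ 1 + c * c + d * d = 0 ∧ a * c + b * d = 0 := by
  obtain ⟨⟨u, hu⟩, hu'⟩ := hC.proj_surjective ![1, 0]
  obtain ⟨⟨v, hv⟩, hv'⟩ := hC.proj_surjective ![0, 1]
  have u0 : u 0 = 1 := congrFun hu' 0
  have u1 : u 1 = 0 := congrFun hu' 1
  have v0 : v 0 = 0 := congrFun hv' 0
  have v1 : v 1 = 1 := congrFun hv' 1
  have eu : ![1, 0, u 2, u 3] = u := by
    ext i; fin_cases i <;> simp [u0, u1]
  have ev : ![0, 1, v 2, v 3] = v := by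
    ext i; fin_cases i <;> simp [v0, v1]
  refine ⟨u 2, u 3, v 2, v 3, ?_, ?_, ?_, ?_⟩
  · rw [eu, ev]
    apply le_antisymm
    · intro x hx
      rw [Submodule.mem_span_pair]
      refine ⟨x 0, x 1, (sub_eq_zero.1 (hC.eq_zero (C.sub_mem hx (C.add_mem
        (C.smul_mem _ hu) (C.smul_mem _ hv))) ?_ ?_)).symm⟩ <;> simp [u0, u1, v0, v1]
    · exact Submodule.span_le.2 (Set.pair_subset hu hv)
  · simpa [Fin.sum_univ_four, u0, u1] using hC.2 u hu u hu
  · simpa [Fin.sum_univ_four, v0, v1] using hC.2 v hv v hv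
  · simpa [Fin.sum_univ_four, u0, u1, v0, v1] using hC.2 u hu v hv

lemma IsSelfDualCode.eq_codeImage_span_pair {C : Submodule (ZMod 3) (Fin 4 → ZMod 3)}
    (hC : IsSelfDualCode C) {g : Matrix (Fin 4) (Fin 4) (ZMod 3)} {r s u v : Fin 4 → ZMod 3}
    (hspan : C = Submodule.span (ZMod 3) {u, v})
    (hu : ∃ p q : ZMod 3, p • g.mulVec r + q • g.mulVec s = u)
    (hv : ∃ p q : ZMod 3, p • g.mulVec r + q • g.mulVec s = v) :
    C = codeImage g (Submodule.span (ZMod 3) {r, s}) := by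
  refine Submodule.eq_of_le_of_finrank_le ?_ ?_
  · rw [hspan, Submodule.span_le]
    exact Set.pair_subset (mem_codeImage_span_pair.2 hu) (mem_codeImage_span_pair.2 hv)
  · rw [hC.1]
    exact finrank_codeImage_span_pair_le g r s

lemma g1m_mulVec (x : Fin 4 → ZMod 3) : g1m.mulVec x = ![x 2, -x 3, x 0, -x 1] := by
  ext i; fin_cases i <;> simp [g1m, Matrix.mulVec, dotProduct, Fin.sum_univ_four]

lemma g2m_mulVec (x : Fin 4 → ZMod 3) : g2m.mulVec x = ![x 1, x 0, -x 3, -x 2] := by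
  ext i; fin_cases i <;> simp [g2m, Matrix.mulVec, dotProduct, Fin.sum_univ_four]

set_option synthInstance.maxSize 4000 in
/-- Every standard-form generator matrix of a self-dual code has its rows in some `g(C₁)` or
`g(C₂)`. -/
lemma standard_form_rows_mem : ∀ a b c d : ZMod 3,
    1 + a * a + b * b = 0 → 1 + c * c + d * d = 0 → a * c + b * d = 0 →
    ∃ g ∈ [1, g1m, g2m, g2m * g1m],
      ((∃ p q : ZMod 3, p • g.mulVec ![1, 0, -1, -1] + q • g.mulVec ![0, 1, 1, -1] =
          ![1, 0, a, b]) ∧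
        ∃ p q : ZMod 3, p • g.mulVec ![1, 0, -1, -1] + q • g.mulVec ![0, 1, 1, -1] =
          ![0, 1, c, d]) ∨
      ((∃ p q : ZMod 3, p • g.mulVec ![1, 0, -1, 1] + q • g.mulVec ![0, 1, 1, 1] =
          ![1, 0, a, b]) ∧
        ∃ p q : ZMod 3, p • g.mulVec ![1, 0, -1, 1] + q • g.mulVec ![0, 1, 1, 1] =
          ![0, 1, c, d]) := by
  simp [← Matrix.mulVec_mulVec, g1m_mulVec, g2m_mulVec]
  decide +kernel

lemma not_generators_mem_C2 : ∀ g ∈ [1, g1m, g2m, g2m * g1m],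
    ¬((∃ p q : ZMod 3, p • ![1, 0, -1, 1] + q • ![0, 1, 1, 1] = g.mulVec ![1, 0, -1, -1]) ∧
      ∃ p q : ZMod 3, p • ![1, 0, -1, 1] + q • ![0, 1, 1, 1] = g.mulVec ![0, 1, 1, -1]) := by
  simp [← Matrix.mulVec_mulVec, g1m_mulVec, g2m_mulVec]
  decide +kernel

/-- The `K₄`-action on self-dual codes has exactly two orbits: every self-dual code is
the image of `C₁` or of `C₂` under some `g ∈ K₄`, and no `g ∈ K₄` maps `C₁` to `C₂`. -/
theorem two_orbits_of_self_dual_codes :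
    (∀ C : Submodule (ZMod 3) (Fin 4 → ZMod 3), IsSelfDualCode C →
      (∃ g ∈ K4, C = codeImage g C1) ∨ (∃ g ∈ K4, C = codeImage g C2)) ∧
    ¬ ∃ g ∈ K4, codeImage g C1 = C2 := by
  have hK (g) : g ∈ K4 ↔ g ∈ [1, g1m, g2m, g2m * g1m] := by simp [K4]
  constructor
  · intro C hC
    obtain ⟨a, b, c, d, hspan, hu, hv, huv⟩ := hC.exists_standard_form
    obtain ⟨g, hg, ⟨h, h'⟩ | ⟨h, h'⟩⟩ := standard_form_rows_mem a b c d hu hv huv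
    · exact Or.inl ⟨g, (hK g).2 hg, hC.eq_codeImage_span_pair hspan h h'⟩
    · exact Or.inr ⟨g, (hK g).2 hg, hC.eq_codeImage_span_pair hspan h h'⟩
  · rintro ⟨g, hg, h⟩
    have mem_C2 {x} (hx : x ∈ C1) : ∃ p q : ZMod 3, p • ![1, 0, -1, 1] + q • ![0, 1, 1, 1] =
        g.mulVec x :=
      Submodule.mem_span_pair.1 (h.le (Submodule.mem_map_of_mem hx))
    exact not_generators_mem_C2 g ((hK g).1 hg)
      ⟨mem_C2 (Submodule.subset_span (by simp)), mem_C2 (Submodule.subset_span (by simp))⟩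
end
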